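/- arXiv:1309.0243 — 10 statements merged into one kernel-verified Lean document; each statement's English description precedes it below -/
import Mathlib

section
/- Let F = (X; f_1,…,f_N) be an IFS on a complete metric space X with attractor A and basin of attraction U, and suppose that the induced map F : H(U) → H(U) is well defined and continuous with respect to the Hausdorff metric. Then for every subset B ⊆ U whose closure is compact and contained in U, A = ⋂_{K≥1} closure( ⋃_{k≥K} F^k(B) ). -/
open Metric Filter TopologicalSpace

/-- If `F` is an IFS on a complete metric space with attractor `A` and basin of
attraction `U`, and the induced map on the hyperspace of nonempty compact subsets of `U`
is well defined and continuous, then for every `B ⊆ U` with compact closure contained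
in `U`, the attractor is the intersection over `K ≥ 1` of the closures of the tails
`⋃_{k ≥ K} F^k(B)`. -/
theorem stmt1 {X : Type*} [MetricSpace X] [CompleteSpace X]
    (N : ℕ) (hN : 0 < N) (f : Fin N → X → X) (hf : ∀ i, Continuous (f i))
    (F : Set X → Set X) (hF : ∀ S, F S = ⋃ i, f i '' S)
    (A U : Set X) (hAne : A.Nonempty) (hAcpt : IsCompact A)
    (hU : IsOpen U) (hAU : A ⊆ U)
    (hbasin : ∀ B : Set X, B.Nonempty → IsCompact B → B ⊆ U →
      Tendsto (fun k => hausdorffDist (F^[k] B) A) atTop (nhds 0))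
    (hlargest : ∀ U' : Set X, IsOpen U' → A ⊆ U' →
      (∀ B : Set X, B.Nonempty → IsCompact B → B ⊆ U' →
        Tendsto (fun k => hausdorffDist (F^[k] B) A) atTop (nhds 0)) → U' ⊆ U)
    (hwd : ∀ S : Set X, S.Nonempty → IsCompact S → S ⊆ U →
      (F S).Nonempty ∧ IsCompact (F S) ∧ F S ⊆ U)
    (FH : NonemptyCompacts X → NonemptyCompacts X)
    (hFH : ∀ K : NonemptyCompacts X, (FH K : Set X) = F (K : Set X))
    (hcont : ContinuousOn FH {K : NonemptyCompacts X | (K : Set X) ⊆ U}) :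
    ∀ B : Set X, B ⊆ U → B.Nonempty → IsCompact (closure B) → closure B ⊆ U →
      A = ⋂ (K : ℕ), ⋂ (_ : 1 ≤ K), closure (⋃ k, ⋃ (_ : K ≤ k), F^[k] B) := by
  intro B hBU hBne hBc hcBU
  have hmono : ∀ S T : Set X, S ⊆ T → F S ⊆ F T := by
    intro S T h
    rw [hF, hF]
    exact Set.iUnion_mono fun i => Set.image_mono h
  have hcl : ∀ S : Set X, F (closure S) ⊆ closure (F S) := by
    intro S
    rw [hF, hF]
    refine Set.iUnion_subset fun i => ?_
    exact (image_closure_subset_closure_image (hf i)).trans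
      (closure_mono (Set.subset_iUnion (fun i => f i '' S) i))
  have hmk : ∀ k : ℕ, F^[k] B ⊆ F^[k] (closure B) := by
    intro k
    induction k with
    | zero => exact subset_closure
    | succ k ih =>
      rw [Function.iterate_succ_apply', Function.iterate_succ_apply']
      exact hmono _ _ ih
  have hck : ∀ k : ℕ, F^[k] (closure B) ⊆ closure (F^[k] B) := by
    intro k
    induction k with
    | zero => exact subset_rfl
    | succ k ih =>
      rw [Function.iterate_succ_apply', Function.iterate_succ_apply']
      exact (hmono _ _ ih).trans (hcl _)
  have hk : ∀ k : ℕ, (F^[k] (closure B)).Nonempty ∧ IsCompact (F^[k] (closure B)) ∧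
      F^[k] (closure B) ⊆ U := by
    intro k
    induction k with
    | zero => exact ⟨hBne.closure, hBc, hcBU⟩
    | succ k ih =>
      rw [Function.iterate_succ_apply']
      exact hwd _ ih.1 ih.2.1 ih.2.2
  have hfin : ∀ k : ℕ, hausdorffEDist (F^[k] (closure B)) A ≠ ⊤ := fun k =>
    hausdorffEDist_ne_top_of_nonempty_of_bounded (hk k).1 hAne (hk k).2.1.isBounded
      hAcpt.isBounded
  have hlim := hbasin (closure B) hBne.closure hBc hcBU
  have hev : ∀ ε > 0, ∃ K : ℕ, ∀ k ≥ K, hausdorffDist (F^[k] (closure B)) A < ε := by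
    intro ε hε
    exact eventually_atTop.1 (hlim.eventually (gt_mem_nhds hε))
  apply Set.Subset.antisymm
  · intro a ha
    simp only [Set.mem_iInter]
    intro K _
    rw [Metric.mem_closure_iff]
    intro ε hε
    obtain ⟨M, hM⟩ := hev (ε / 2) (half_pos hε)
    obtain ⟨y, hy, hay⟩ := exists_dist_lt_of_hausdorffDist_lt' ha
      (hM (max K M) (le_max_right _ _)) (hfin _)
    obtain ⟨z, hz, hyz⟩ := Metric.mem_closure_iff.1 (hck _ hy) (ε / 2) (half_pos hε)
    refine ⟨z, Set.mem_iUnion₂.2 ⟨max K M, le_max_left _ _, hz⟩, ?_⟩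
    have := dist_triangle a y z
    rw [dist_comm] at hay
    linarith [dist_comm a y]
  · intro x hx
    simp only [Set.mem_iInter] at hx
    rw [← hAcpt.isClosed.closure_eq, Metric.mem_closure_iff]
    intro ε hε
    obtain ⟨M, hM⟩ := hev (ε / 2) (half_pos hε)
    obtain ⟨y, hy, hxy⟩ := Metric.mem_closure_iff.1 (hx (M + 1) (by omega)) (ε / 2) (half_pos hε)
    obtain ⟨k, hkM, hyk⟩ := Set.mem_iUnion₂.1 hy
    obtain ⟨a, ha, hya⟩ := exists_dist_lt_of_hausdorffDist_lt (hmk k hyk)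
      (hM k (by omega)) (hfin k)
    exact ⟨a, ha, by linarith [dist_triangle x y a]⟩
end

section
/- Let X be a compact metric space, let X_1,…,X_N be nonempty closed subsets of X, and for each i let f_i : X_i → X be a contraction (Lipschitz with constant < 1) satisfying f_i(X_i) ⊆ X_i. Define K_0 := X and K_n := ⋃_{i=1}^N f_i(K_{n-1} ∩ X_i) for n ≥ 1. Then every K_n is a nonempty compact set, K_{n+1} ⊆ K_n for all n, and K := ⋂_{n≥0} K_n is a nonempty compact set satisfying the self-referential equation K = ⋃_{i=1}^N f_i(K ∩ X_i). -/
/-- For a contractive local IFS on a compact metric space, with closed nonempty domains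
`Xᵢ` satisfying `fᵢ(Xᵢ) ⊆ Xᵢ`, the iteration `K₀ = X`, `Kₙ = ⋃ᵢ fᵢ(Kₙ₋₁ ∩ Xᵢ)` produces
a decreasing sequence of nonempty compact sets whose intersection is a nonempty compact
set satisfying the self-referential equation. -/
theorem stmt2 {X : Type*} [MetricSpace X] [CompactSpace X]
    (N : ℕ) (hN : 0 < N) (Xi : Fin N → Set X)
    (hXine : ∀ i, (Xi i).Nonempty) (hXicl : ∀ i, IsClosed (Xi i))
    (f : Fin N → X → X) (c : Fin N → ℝ) (hc0 : ∀ i, 0 ≤ c i) (hc1 : ∀ i, c i < 1)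
    (hlip : ∀ i, ∀ x ∈ Xi i, ∀ y ∈ Xi i, dist (f i x) (f i y) ≤ c i * dist x y)
    (hinv : ∀ i, f i '' Xi i ⊆ Xi i)
    (K : ℕ → Set X) (hK0 : K 0 = Set.univ)
    (hKn : ∀ n, K (n + 1) = ⋃ i, f i '' (K n ∩ Xi i)) :
    (∀ n, (K n).Nonempty ∧ IsCompact (K n)) ∧
    (∀ n, K (n + 1) ⊆ K n) ∧
    (⋂ n, K n).Nonempty ∧ IsCompact (⋂ n, K n) ∧
    (⋂ n, K n) = ⋃ i, f i '' ((⋂ n, K n) ∩ Xi i) := by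
  have hcont : ∀ i, ContinuousOn (f i) (Xi i) := by
    intro i
    have h : LipschitzOnWith (Real.toNNReal (c i)) (f i) (Xi i) := by
      apply LipschitzOnWith.of_dist_le_mul
      intro x hx y hy
      rw [Real.coe_toNNReal _ (hc0 i)]
      exact hlip i x hx y hy
    exact h.continuousOn
  have hcomp : ∀ n, IsCompact (K n) := by
    intro n
    induction n with
    | zero => rw [hK0]; exact isCompact_univ
    | succ n ih =>
      rw [hKn]
      exact isCompact_iUnion fun i =>
        (ih.inter_right (hXicl i)).image_of_continuousOn
          ((hcont i).mono Set.inter_subset_right)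
  have hmeet : ∀ i n, (K n ∩ Xi i).Nonempty := by
    intro i n
    induction n with
    | zero => rw [hK0, Set.univ_inter]; exact hXine i
    | succ n ih =>
      obtain ⟨x, hx⟩ := ih
      refine ⟨f i x, ?_, hinv i ⟨x, hx.2, rfl⟩⟩
      rw [hKn]
      exact Set.mem_iUnion.2 ⟨i, x, hx, rfl⟩
  have hne : ∀ n, (K n).Nonempty := fun n => (hmeet ⟨0, hN⟩ n).mono Set.inter_subset_left
  have hdec : ∀ n, K (n + 1) ⊆ K n := by
    intro n
    induction n with
    | zero => rw [hK0]; exact Set.subset_univ _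
    | succ n ih =>
      have h : (⋃ i, f i '' (K (n + 1) ∩ Xi i)) ⊆ ⋃ i, f i '' (K n ∩ Xi i) :=
        Set.iUnion_mono fun i => Set.image_mono (Set.inter_subset_inter_left _ ih)
      rwa [← hKn (n + 1), ← hKn n] at h
  have hanti : Antitone K := antitone_nat_of_succ_le hdec
  refine ⟨fun n => ⟨hne n, hcomp n⟩, hdec, ?_, ?_, ?_⟩
  · exact IsCompact.nonempty_iInter_of_sequence_nonempty_isCompact_isClosed K hdec hne
      (hcomp 0) fun n => (hcomp n).isClosed
  · exact (isClosed_iInter fun n => (hcomp n).isClosed).isCompact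
  · apply Set.Subset.antisymm
    · intro x hx
      rw [Set.mem_iInter] at hx
      have hex : ∃ i, ∀ n, (K n ∩ (Xi i ∩ f i ⁻¹' {x})).Nonempty := by
        by_contra! h
        choose m hm using h
        have hx' := hx (Finset.univ.sup m + 1)
        rw [hKn] at hx'
        obtain ⟨i, y, hy, hyx⟩ := Set.mem_iUnion.1 hx'
        have : y ∈ K (m i) ∩ (Xi i ∩ f i ⁻¹' {x}) :=
          ⟨hanti (Finset.le_sup (Finset.mem_univ i)) hy.1, hy.2, hyx⟩
        rw [hm i] at this
        exact this
      obtain ⟨i, hi⟩ := hex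
      have hcl : IsClosed (Xi i ∩ f i ⁻¹' {x}) :=
        (hcont i).preimage_isClosed_of_isClosed (hXicl i) isClosed_singleton
      obtain ⟨y, hy⟩ := IsCompact.nonempty_iInter_of_sequence_nonempty_isCompact_isClosed
        (fun n => K n ∩ (Xi i ∩ f i ⁻¹' {x}))
        (fun n => Set.inter_subset_inter_left _ (hdec n)) hi
        ((hcomp 0).inter_right hcl) (fun n => (hcomp n).isClosed.inter hcl)
      rw [Set.mem_iInter] at hy
      exact Set.mem_iUnion.2 ⟨i, y, ⟨Set.mem_iInter.2 fun n => (hy n).1, (hy 0).2.1⟩, (hy 0).2.2⟩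
    · intro x hx
      obtain ⟨i, y, hy, hyx⟩ := Set.mem_iUnion.1 hx
      refine Set.mem_iInter.2 fun n => hdec n ?_
      rw [hKn]
      exact Set.mem_iUnion.2 ⟨i, y, ⟨Set.mem_iInter.1 hy.1 n, hy.2⟩, hyx⟩
end

section
/- Let X be a compact metric space, let X_1,…,X_N be closed subsets of X, and let f_1,…,f_N : X → X be contractions (Lipschitz with constant < 1). Let A be the unique nonempty compact subset of X satisfying A = ⋃_{i=1}^N f_i(A) (the attractor of the IFS {X; f_1,…,f_N}). Then every compact set B ⊆ X satisfying the local self-referential equation B = ⋃_{i=1}^N f_i(B ∩ X_i) is contained in A; in particular, the local attractor of the local IFS {X; (X_i, f_i|_{X_i})} is a subset of A. -/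
/-- Every compact set `B` satisfying the local self-referential equation
`B = ⋃ᵢ fᵢ(B ∩ Xᵢ)` of a contractive local IFS on a compact metric space is contained
in the attractor `A` of the associated global IFS; in particular the local attractor
is a subset of `A`. -/
theorem stmt3 {X : Type*} [MetricSpace X] [CompactSpace X]
    (N : ℕ) (hN : 0 < N) (Xi : Fin N → Set X) (hXicl : ∀ i, IsClosed (Xi i))
    (f : Fin N → X → X) (c : Fin N → ℝ) (hc0 : ∀ i, 0 ≤ c i) (hc1 : ∀ i, c i < 1)
    (hlip : ∀ i x y, dist (f i x) (f i y) ≤ c i * dist x y)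
    (A : Set X) (hAne : A.Nonempty) (hAcpt : IsCompact A)
    (hA : A = ⋃ i, f i '' A)
    (hAuniq : ∀ A' : Set X, A'.Nonempty → IsCompact A' → A' = ⋃ i, f i '' A' → A' = A) :
    ∀ B : Set X, IsCompact B → B = ⋃ i, f i '' (B ∩ Xi i) → B ⊆ A := by
  intro B hB hBeq z hz
  obtain ⟨x, hx, hmax⟩ := hB.exists_isMaxOn ⟨z, hz⟩
    (Metric.continuous_infDist_pt A).continuousOn
  have hx' := hx
  rw [hBeq] at hx'
  obtain ⟨i, y, ⟨hyB, -⟩, rfl⟩ := Set.mem_iUnion.1 hx'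
  obtain ⟨a, ha, hya⟩ := hAcpt.exists_infDist_eq_dist hAne y
  have hfa : f i a ∈ A := by
    rw [hA]
    exact Set.mem_iUnion.2 ⟨i, a, ha, rfl⟩
  have h1 : Metric.infDist (f i y) A ≤ dist (f i y) (f i a) := Metric.infDist_le_dist_of_mem hfa
  have h2 := hlip i y a
  have h3 : Metric.infDist y A ≤ Metric.infDist (f i y) A := hmax hyB
  have h4 : Metric.infDist z A ≤ Metric.infDist (f i y) A := hmax hz
  have h5 : 0 ≤ Metric.infDist z A := Metric.infDist_nonneg
  rw [← hya] at h2
  have h6 := mul_le_mul_of_nonneg_left h3 (hc0 i)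
  have h7 : Metric.infDist z A = 0 := by nlinarith [hc1 i]
  exact (hAcpt.isClosed.mem_iff_infDist_zero hAne).2 h7
end

section
/- Let X be a nonempty set, let X_1,…,X_N be nonempty subsets of X, and let u_i : X_i → X be bijections onto their images such that the sets u_i(X_i) are pairwise disjoint and cover X. Let (Y,d_Y) be a complete metric space and for each i let v_i : X_i × Y → Y satisfy: (a) there is ℓ ∈ [0,1) with d_Y(v_i(x,y_1), v_i(x,y_2)) ≤ ℓ·d_Y(y_1,y_2) for all x ∈ X_i, y_1,y_2 ∈ Y; (b) for each i and each y ∈ Y, the function x ↦ v_i(x,y) has bounded range. Then the Read–Bajraktarević operator Φ defined by Φf(x) := v_i(u_i^{-1}(x), f(u_i^{-1}(x))) for x ∈ u_i(X_i) maps B(X,Y) into itself, satisfies d(Φf, Φg) ≤ ℓ·d(f,g) for all f,g ∈ B(X,Y), and consequently has a unique fixed point in B(X,Y). -/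
open Bornology

/-- The Read–Bajraktarević operator associated with a partition `{uᵢ(Xᵢ)}` of `X` and
maps `vᵢ` that are uniformly contractive in the second variable and have bounded range
in the first variable maps the space `B(X,Y)` of bounded functions into itself, is a
contraction with factor `ℓ` in the sup metric, and hence has a unique bounded fixed
point. -/
theorem stmt4 {X Y : Type*} [Nonempty X] [Nonempty Y] [MetricSpace Y] [CompleteSpace Y]
    (N : ℕ) (Xi : Fin N → Set X) (hXine : ∀ i, (Xi i).Nonempty)
    (u : Fin N → X → X) (huinj : ∀ i, Set.InjOn (u i) (Xi i))
    (hcover : (⋃ i, u i '' Xi i) = Set.univ)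
    (hdisj : ∀ i j, i ≠ j → Disjoint (u i '' Xi i) (u j '' Xi j))
    (v : Fin N → X → Y → Y) (ℓ : ℝ) (hℓ0 : 0 ≤ ℓ) (hℓ1 : ℓ < 1)
    (hcontr : ∀ i, ∀ x ∈ Xi i, ∀ y₁ y₂ : Y, dist (v i x y₁) (v i x y₂) ≤ ℓ * dist y₁ y₂)
    (hbd : ∀ i (y : Y), IsBounded ((fun x => v i x y) '' Xi i))
    (Φ : (X → Y) → (X → Y))
    (hΦ : ∀ (f : X → Y) (i), ∀ x ∈ Xi i, Φ f (u i x) = v i x (f x)) :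
    (∀ f : X → Y, IsBounded (Set.range f) → IsBounded (Set.range (Φ f))) ∧
    (∀ f g : X → Y, IsBounded (Set.range f) → IsBounded (Set.range g) →
      (⨆ x, dist (Φ f x) (Φ g x)) ≤ ℓ * ⨆ x, dist (f x) (g x)) ∧
    (∃! f : X → Y, IsBounded (Set.range f) ∧ Φ f = f) := by
  have key : ∀ (f g : X → Y) (C : ℝ), (∀ x, dist (f x) (g x) ≤ C) →
      ∀ x, dist (Φ f x) (Φ g x) ≤ ℓ * C := by
    intro f g C h x
    have hx : x ∈ ⋃ i, u i '' Xi i := hcover ▸ Set.mem_univ x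
    obtain ⟨i, z, hz, rfl⟩ := Set.mem_iUnion.1 hx
    rw [hΦ f i z hz, hΦ g i z hz]
    exact (hcontr i z hz _ _).trans (mul_le_mul_of_nonneg_left (h z) hℓ0)
  have hmap : ∀ f : X → Y, IsBounded (Set.range f) → IsBounded (Set.range (Φ f)) := by
    intro f hf
    obtain ⟨y⟩ := ‹Nonempty Y›
    have hc : IsBounded (Set.range (Φ (fun _ => y))) := by
      refine ((isBounded_iUnion).2 (fun i => hbd i y)).subset ?_
      rintro _ ⟨x, rfl⟩
      have hx : x ∈ ⋃ i, u i '' Xi i := hcover ▸ Set.mem_univ x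
      obtain ⟨i, z, hz, rfl⟩ := Set.mem_iUnion.1 hx
      rw [hΦ _ i z hz]
      exact Set.mem_iUnion.2 ⟨i, z, hz, rfl⟩
    obtain ⟨C, hC⟩ := hf.subset_closedBall y
    obtain ⟨D, hD⟩ := hc.subset_closedBall y
    refine Metric.isBounded_closedBall.subset (s := Set.range (Φ f))
      (t := Metric.closedBall y (ℓ * C + D)) ?_
    rintro _ ⟨x, rfl⟩
    have h1 := key f (fun _ => y) C (fun x => hC ⟨x, rfl⟩) x
    have h2 : dist (Φ (fun _ => y) x) y ≤ D := hD ⟨x, rfl⟩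
    exact (dist_triangle _ _ _).trans (add_le_add h1 h2)
  have hbdd : ∀ f g : X → Y, IsBounded (Set.range f) → IsBounded (Set.range g) →
      BddAbove (Set.range fun x => dist (f x) (g x)) := by
    intro f g hf hg
    obtain ⟨C, hC⟩ := Metric.isBounded_iff.1 (hf.union hg)
    refine ⟨C, ?_⟩
    rintro _ ⟨x, rfl⟩
    exact hC (Or.inl ⟨x, rfl⟩) (Or.inr ⟨x, rfl⟩)
  have hcon : ∀ f g : X → Y, IsBounded (Set.range f) → IsBounded (Set.range g) →
      (⨆ x, dist (Φ f x) (Φ g x)) ≤ ℓ * ⨆ x, dist (f x) (g x) := by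
    intro f g hf hg
    exact ciSup_le (key f g _ (fun x => le_ciSup (hbdd f g hf hg) x))
  refine ⟨hmap, hcon, ?_⟩
  let _ : TopologicalSpace X := ⊥
  have : DiscreteTopology X := ⟨rfl⟩
  let mk : ∀ f : X → Y, IsBounded (Set.range f) → BoundedContinuousFunction X Y := fun f hf =>
    ⟨⟨f, continuous_of_discreteTopology⟩, Metric.isBounded_range_iff.1 hf⟩
  let T : BoundedContinuousFunction X Y → BoundedContinuousFunction X Y := fun f =>
    mk (Φ f) (hmap f f.isBounded_range)
  have hT : ContractingWith ⟨ℓ, hℓ0⟩ T := by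
    refine ⟨by exact_mod_cast hℓ1, LipschitzWith.of_dist_le_mul fun f g => ?_⟩
    refine (BoundedContinuousFunction.dist_le (mul_nonneg hℓ0 dist_nonneg)).2 ?_
    exact key f g _ (fun x => BoundedContinuousFunction.dist_coe_le_dist x)
  have : Nonempty (BoundedContinuousFunction X Y) :=
    ⟨BoundedContinuousFunction.const X (Classical.arbitrary Y)⟩
  have hfix : T (hT.fixedPoint T) = hT.fixedPoint T := hT.fixedPoint_isFixedPt
  refine ⟨(hT.fixedPoint T : BoundedContinuousFunction X Y), ⟨BoundedContinuousFunction.isBounded_range _, ?_⟩, ?_⟩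
  · exact congrArg (fun f : BoundedContinuousFunction X Y => (f : X → Y)) hfix
  · rintro g ⟨hg, hgf⟩
    have : Function.IsFixedPt T (mk g hg) := by
      ext x
      exact congrFun hgf x
    exact congrArg (fun f : BoundedContinuousFunction X Y => (f : X → Y))
      (hT.fixedPoint_unique this)
end

section
/- Let Y be a real vector space carrying a complete metric d_Y that is translation-invariant (d_Y(y+a, z+a) = d_Y(y,z)) and homogeneous (d_Y(αy, αz) = |α|·d_Y(y,z) for all α ∈ ℝ). Let X be a nonempty set, X_1,…,X_N nonempty subsets of X, and u_i : X_i → X bijections onto their images such that the sets u_i(X_i) are pairwise disjoint and cover X. Let λ_i ∈ B(X_i,Y) and let S_i : X_i → ℝ be bounded with s := max_i sup_{x∈X_i} |S_i(x)| < 1. Then the operator Φ defined by Φf(x) := λ_i(u_i^{-1}(x)) + S_i(u_i^{-1}(x))·f(u_i^{-1}(x)) for x ∈ u_i(X_i) maps B(X,Y) into itself, satisfies d(Φf,Φg) ≤ s·d(f,g) for all f,g ∈ B(X,Y), and has a unique fixed point 𝔣 ∈ B(X,Y) which satisfies the self-referential equation 𝔣(u_i(x)) = λ_i(x) + S_i(x)·𝔣(x)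 for all x ∈ X_i and all i = 1,…,N. -/
open Bornology

/-- The affine Read–Bajraktarević operator `Φf = λᵢ ∘ uᵢ⁻¹ + (Sᵢ ∘ uᵢ⁻¹)·(f ∘ uᵢ⁻¹)` on
an F-space `Y` with homogeneous translation-invariant metric maps `B(X,Y)` into itself,
is a contraction with factor `s = maxᵢ sup |Sᵢ| < 1`, and its unique bounded fixed point
`𝔣` satisfies the self-referential equation `𝔣(uᵢ(x)) = λᵢ(x) + Sᵢ(x)·𝔣(x)` on `Xᵢ`. -/
theorem stmt5 {X Y : Type*} [Nonempty X]
    [AddCommGroup Y] [Module ℝ Y] [MetricSpace Y] [CompleteSpace Y]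
    (htrans : ∀ a y z : Y, dist (y + a) (z + a) = dist y z)
    (hhom : ∀ (α : ℝ) (y z : Y), dist (α • y) (α • z) = |α| * dist y z)
    (N : ℕ) (Xi : Fin N → Set X) (hXine : ∀ i, (Xi i).Nonempty)
    (u : Fin N → X → X) (huinj : ∀ i, Set.InjOn (u i) (Xi i))
    (hcover : (⋃ i, u i '' Xi i) = Set.univ)
    (hdisj : ∀ i j, i ≠ j → Disjoint (u i '' Xi i) (u j '' Xi j))
    (lam : Fin N → X → Y) (hlambd : ∀ i, IsBounded (lam i '' Xi i))
    (S : Fin N → X → ℝ) (s : ℝ) (hs0 : 0 ≤ s) (hs1 : s < 1)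
    (hSbd : ∀ i, ∀ x ∈ Xi i, |S i x| ≤ s)
    (Φ : (X → Y) → (X → Y))
    (hΦ : ∀ (f : X → Y) (i), ∀ x ∈ Xi i, Φ f (u i x) = lam i x + S i x • f x) :
    (∀ f : X → Y, IsBounded (Set.range f) → IsBounded (Set.range (Φ f))) ∧
    (∀ f g : X → Y, IsBounded (Set.range f) → IsBounded (Set.range g) →
      (⨆ x, dist (Φ f x) (Φ g x)) ≤ s * ⨆ x, dist (f x) (g x)) ∧
    (∃! f : X → Y, IsBounded (Set.range f) ∧ Φ f = f) ∧
    (∀ f : X → Y, IsBounded (Set.range f) → Φ f = f →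
      ∀ i, ∀ x ∈ Xi i, f (u i x) = lam i x + S i x • f x) := by
  have hpt : ∀ (x : X), ∃ i, ∃ y ∈ Xi i, u i y = x := by
    intro x
    have hx : x ∈ (⋃ i, u i '' Xi i) := by rw [hcover]; trivial
    obtain ⟨i, y, hy, rfl⟩ := Set.mem_iUnion.1 hx
    exact ⟨i, y, hy, rfl⟩
  have h1 : ∀ f : X → Y, IsBounded (Set.range f) → IsBounded (Set.range (Φ f)) := by
    intro f hf
    obtain ⟨C, hC⟩ := (Metric.isBounded_iff_subset_closedBall (0 : Y)).1 hf
    have hl : IsBounded (⋃ i, lam i '' Xi i) := Bornology.isBounded_iUnion.2 hlambd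
    obtain ⟨L, hL⟩ := (Metric.isBounded_iff_subset_closedBall (0 : Y)).1 hl
    refine (Metric.isBounded_iff_subset_closedBall (0 : Y)).2 ⟨L + s * C, ?_⟩
    rintro _ ⟨x, rfl⟩
    obtain ⟨i, y, hy, rfl⟩ := hpt x
    have e1 : dist (lam i y) 0 ≤ L := hL (Set.mem_iUnion.2 ⟨i, y, hy, rfl⟩)
    have e2 : dist (f y) 0 ≤ C := hC ⟨y, rfl⟩
    have e3 : dist (S i y • f y) 0 = |S i y| * dist (f y) 0 := by
      have := hhom (S i y) (f y) 0
      rwa [smul_zero] at this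
    have e4 : |S i y| * dist (f y) 0 ≤ s * C :=
      mul_le_mul (hSbd i y hy) e2 dist_nonneg hs0
    have e5 := htrans (S i y • f y) (lam i y) 0
    have e6 := dist_triangle (lam i y + S i y • f y) (0 + S i y • f y) 0
    rw [zero_add] at e5 e6
    rw [Metric.mem_closedBall, hΦ f i y hy]
    linarith
  have h2 : ∀ (f g : X → Y) (D : ℝ), (∀ x, dist (f x) (g x) ≤ D) →
      ∀ x, dist (Φ f x) (Φ g x) ≤ s * D := by
    intro f g D hD x
    obtain ⟨i, y, hy, rfl⟩ := hpt x
    rw [hΦ f i y hy, hΦ g i y hy, add_comm, add_comm (lam i y), htrans, hhom]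
    exact mul_le_mul (hSbd i y hy) (hD y) dist_nonneg hs0
  have hbdd : ∀ f g : X → Y, IsBounded (Set.range f) → IsBounded (Set.range g) →
      BddAbove (Set.range fun x => dist (f x) (g x)) := by
    intro f g hf hg
    obtain ⟨C, hC⟩ := Metric.isBounded_iff.1 (hf.union hg)
    refine ⟨C, ?_⟩
    rintro _ ⟨x, rfl⟩
    exact hC (Or.inl ⟨x, rfl⟩) (Or.inr ⟨x, rfl⟩)
  refine ⟨h1, ?_, ?_, ?_⟩
  · intro f g hf hg
    exact ciSup_le (h2 f g _ fun x => le_ciSup (hbdd f g hf hg) x)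
  · letI : TopologicalSpace X := ⊥
    haveI : DiscreteTopology X := ⟨rfl⟩
    have hb : ∀ f : BoundedContinuousFunction X Y, IsBounded (Set.range f) :=
      fun f => f.isBounded_range
    have hmk : ∀ f : X → Y, IsBounded (Set.range f) →
        ∃ F : BoundedContinuousFunction X Y, (F : X → Y) = f := by
      intro f hf
      obtain ⟨C, hC⟩ := Metric.isBounded_iff.1 hf
      exact ⟨BoundedContinuousFunction.mkOfDiscrete f C
        fun x y => hC ⟨x, rfl⟩ ⟨y, rfl⟩, rfl⟩
    choose T hT using fun F : BoundedContinuousFunction X Y => hmk (Φ F) (h1 F (hb F))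
    have hc : ContractingWith ⟨s, hs0⟩ T := by
      refine ⟨by exact_mod_cast hs1, LipschitzWith.of_dist_le_mul fun F G => ?_⟩
      refine (BoundedContinuousFunction.dist_le (mul_nonneg hs0 dist_nonneg)).2 fun x => ?_
      rw [hT, hT]
      exact h2 F G _ (fun x => BoundedContinuousFunction.dist_coe_le_dist x) x
    haveI : Nonempty (BoundedContinuousFunction X Y) :=
      ⟨BoundedContinuousFunction.const X 0⟩
    have hfix : T (ContractingWith.fixedPoint T hc) = ContractingWith.fixedPoint T hc :=
      hc.fixedPoint_isFixedPt
    generalize hP : ContractingWith.fixedPoint T hc = P at hfix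
    refine ⟨P, ⟨hb _, ?_⟩, ?_⟩
    · rw [← hT, hfix]
    · rintro g ⟨hg, hgf⟩
      obtain ⟨G, rfl⟩ := hmk g hg
      have hG : T G = G := DFunLike.coe_injective (by rw [hT, hgf])
      rw [hc.fixedPoint_unique (x := G) hG, hP]
  · intro f _ hf i x hx
    rw [← hΦ f i x hx, hf]
end

section
/- In the setting of the affine Read–Bajraktarević operator (Y a real vector space with complete, translation-invariant, homogeneous metric d_Y; X a nonempty set; bijections u_i : X_i → X with pairwise disjoint images covering X; bounded S_i : X_i → ℝ fixed with max_i sup|S_i| < 1), for each λ = (λ_1,…,λ_N) ∈ B(X_1,Y) × ⋯ × B(X_N,Y) let 𝔣(λ) ∈ B(X,Y) denote the unique fixed point of the operator Φ(λ) given by Φ(λ)f(x) := λ_i(u_i^{-1}(x)) + S_i(u_i^{-1}(x))·f(u_i^{-1}(x)) for x ∈ u_i(X_i). Then the map λ ↦ 𝔣(λ) is a linear bijection from B(X_1,Y) × ⋯ × B(X_N,Y) onto B(X,Y): it satisfies 𝔣(αλ + βμ) = α𝔣(λ) + β𝔣(μ) for all α,β ∈ ℝ, it is injective, and it is surjective.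 -/
open Bornology

/-- For the affine Read–Bajraktarević operator with fixed scaling functions `Sᵢ`, the
assignment `λ ↦ 𝔣(λ)` taking a tuple of bounded functions `λᵢ ∈ B(Xᵢ,Y)` to the unique
bounded fixed point of `Φ(λ)` is a linear bijection onto `B(X,Y)`. -/
theorem stmt6 {X Y : Type*} [Nonempty X]
    [AddCommGroup Y] [Module ℝ Y] [MetricSpace Y] [CompleteSpace Y]
    (htrans : ∀ a y z : Y, dist (y + a) (z + a) = dist y z)
    (hhom : ∀ (α : ℝ) (y z : Y), dist (α • y) (α • z) = |α| * dist y z)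
    (N : ℕ) (Xi : Fin N → Set X) (hXine : ∀ i, (Xi i).Nonempty)
    (u : Fin N → X → X) (huinj : ∀ i, Set.InjOn (u i) (Xi i))
    (hcover : (⋃ i, u i '' Xi i) = Set.univ)
    (hdisj : ∀ i j, i ≠ j → Disjoint (u i '' Xi i) (u j '' Xi j))
    (S : Fin N → X → ℝ) (s : ℝ) (hs0 : 0 ≤ s) (hs1 : s < 1)
    (hSbd : ∀ i, ∀ x ∈ Xi i, |S i x| ≤ s)
    (FF : (Fin N → X → Y) → (X → Y))
    (hFF : ∀ lam : Fin N → X → Y, (∀ i, IsBounded (lam i '' Xi i)) →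
      IsBounded (Set.range (FF lam)) ∧
      ∀ i, ∀ x ∈ Xi i, FF lam (u i x) = lam i x + S i x • FF lam x) :
    (∀ (α β : ℝ) (lam mu : Fin N → X → Y),
      (∀ i, IsBounded (lam i '' Xi i)) → (∀ i, IsBounded (mu i '' Xi i)) →
      FF (fun i x => α • lam i x + β • mu i x) = fun x => α • FF lam x + β • FF mu x) ∧
    (∀ lam mu : Fin N → X → Y,
      (∀ i, IsBounded (lam i '' Xi i)) → (∀ i, IsBounded (mu i '' Xi i)) →
      FF lam = FF mu → ∀ i, Set.EqOn (lam i) (mu i) (Xi i)) ∧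
    (∀ g : X → Y, IsBounded (Set.range g) →
      ∃ lam : Fin N → X → Y, (∀ i, IsBounded (lam i '' Xi i)) ∧ FF lam = g) := by
  have htrans' : ∀ a y z : Y, dist (a + y) (a + z) = dist y z := by
    intro a y z
    rw [add_comm a y, add_comm a z, htrans]
  have hadd : ∀ a b : Y, dist (a + b) 0 ≤ dist a 0 + dist b 0 := by
    intro a b
    have h1 := dist_triangle (a + b) b 0
    have h2 := htrans b a 0
    rw [zero_add] at h2
    linarith
  have hsm : ∀ (α : ℝ) (y : Y), dist (α • y) 0 = |α| * dist y 0 := by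
    intro α y
    have := hhom α y 0
    rwa [smul_zero] at this
  have hbd : ∀ A : Set Y, IsBounded A ↔ ∃ C, ∀ y ∈ A, dist y 0 ≤ C := by
    intro A
    rw [Metric.isBounded_iff_subset_closedBall (0 : Y)]
    rfl
  have huniq : ∀ (lam : Fin N → X → Y) (f g : X → Y), IsBounded (Set.range f) →
      IsBounded (Set.range g) →
      (∀ i, ∀ x ∈ Xi i, f (u i x) = lam i x + S i x • f x) →
      (∀ i, ∀ x ∈ Xi i, g (u i x) = lam i x + S i x • g x) → f = g := by
    intro lam f g hf hg hfe hge
    obtain ⟨C, hC⟩ := (hbd _).1 hf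
    obtain ⟨D, hD⟩ := (hbd _).1 hg
    have key : ∀ n : ℕ, ∀ x, dist (f x) (g x) ≤ s ^ n * (C + D) := by
      intro n
      induction n with
      | zero =>
        intro x
        have h1 := hC _ ⟨x, rfl⟩
        have h2 := hD _ ⟨x, rfl⟩
        have h3 := dist_triangle_right (f x) (g x) 0
        simp only [pow_zero, one_mul]
        linarith
      | succ n ih =>
        intro x
        have hx : x ∈ ⋃ i, u i '' Xi i := by rw [hcover]; trivial
        obtain ⟨i, z, hz, rfl⟩ := Set.mem_iUnion.1 hx
        rw [hfe i z hz, hge i z hz, htrans', hhom, pow_succ', mul_assoc]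
        exact mul_le_mul (hSbd i z hz) (ih z) dist_nonneg hs0
    funext x
    have hlim : Filter.Tendsto (fun n : ℕ => s ^ n * (C + D)) Filter.atTop (nhds 0) := by
      simpa using (tendsto_pow_atTop_nhds_zero_of_lt_one hs0 hs1).mul_const (C + D)
    have := ge_of_tendsto' hlim (fun n => key n x)
    exact dist_le_zero.1 this
  have hcomb : ∀ (α β : ℝ) (A : Set X) (f g : X → Y), IsBounded (f '' A) → IsBounded (g '' A) →
      IsBounded ((fun x => α • f x + β • g x) '' A) := by
    intro α β A f g hf hg
    obtain ⟨C, hC⟩ := (hbd _).1 hf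
    obtain ⟨D, hD⟩ := (hbd _).1 hg
    refine (hbd _).2 ⟨|α| * C + |β| * D, ?_⟩
    rintro _ ⟨x, hx, rfl⟩
    refine (hadd _ _).trans ?_
    rw [hsm, hsm]
    have h1 := hC _ ⟨x, hx, rfl⟩
    have h2 := hD _ ⟨x, hx, rfl⟩
    gcongr
  refine ⟨?_, ?_, ?_⟩
  · intro α β lam mu hl hm
    have h0 := hFF (fun i x => α • lam i x + β • mu i x)
      (fun i => hcomb α β _ _ _ (hl i) (hm i))
    have h1 := hFF lam hl
    have h2 := hFF mu hm
    refine huniq _ _ _ h0.1 ?_ h0.2 ?_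
    · rw [← Set.image_univ]
      exact hcomb α β _ _ _ (by rw [Set.image_univ]; exact h1.1)
        (by rw [Set.image_univ]; exact h2.1)
    · intro i x hx
      simp only [h1.2 i x hx, h2.2 i x hx]
      module
  · intro lam mu hl hm h i x hx
    have h1 := (hFF lam hl).2 i x hx
    have h2 := (hFF mu hm).2 i x hx
    rw [h, h2] at h1
    exact (add_right_cancel h1).symm
  · intro g hg
    have hb : ∀ i, IsBounded ((fun x => g (u i x) - S i x • g x) '' Xi i) := by
      intro i
      obtain ⟨C, hC⟩ := (hbd _).1 hg
      refine (hbd _).2 ⟨C + s * C, ?_⟩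
      rintro _ ⟨x, hx, rfl⟩
      have h1 := hC _ ⟨u i x, rfl⟩
      have h2 := hC _ ⟨x, rfl⟩
      have h3 := hadd (g (u i x)) ((-S i x) • g x)
      rw [hsm, abs_neg, neg_smul, ← sub_eq_add_neg] at h3
      have h4 := mul_le_mul (hSbd i x hx) h2 dist_nonneg hs0
      show dist (g (u i x) - S i x • g x) 0 ≤ _
      linarith
    refine ⟨fun i x => g (u i x) - S i x • g x, hb, ?_⟩
    have h0 := hFF (fun i x => g (u i x) - S i x • g x) hb
    refine huniq _ _ _ h0.1 hg h0.2 ?_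
    intro i x hx
    simp
end

section
/- Let (X,d_X) and (Y,d_Y) be complete metric spaces, let X_1,…,X_N be nonempty subsets of X, and let u_i : X_i → X be Lipschitz maps with constants a_i, where a := max_i a_i < 1. For each i let v_i : X_i × Y → Y satisfy d_Y(v_i(x,y_1), v_i(x,y_2)) ≤ s·d_Y(y_1,y_2) for all x ∈ X_i (with s ∈ [0,1)) and d_Y(v_i(x_1,y), v_i(x_2,y)) ≤ L·d_X(x_1,x_2) for all y ∈ Y (with L > 0). Set θ := (1−a)/(2L) and define d_θ((x_1,y_1),(x_2,y_2)) := d_X(x_1,x_2) + θ·d_Y(y_1,y_2) on X × Y. Then each map w_i : X_i × Y → X × Y, w_i(x,y) := (u_i(x), v_i(x,y)), satisfies d_θ(w_i(p), w_i(q)) ≤ q·d_θ(p,q) for all p,q ∈ X_i × Y, where q := max{a + θL, s} < 1; in particular the local IFS {X×Y; (X_i×Y, w_i)} is contractive with respect to d_θ. -/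
/-- The maps `wᵢ(x,y) = (uᵢ(x), vᵢ(x,y))` associated with a local fractal function are
contractions with factor `q = max{a + θL, s} < 1` with respect to the metric
`d_θ = d_X + θ d_Y` on `X × Y`, where `θ = (1-a)/(2L)`; hence the local IFS
`{X×Y; (Xᵢ×Y, wᵢ)}` is contractive. -/
theorem stmt8 {X Y : Type*} [MetricSpace X] [MetricSpace Y] [CompleteSpace X] [CompleteSpace Y]
    (N : ℕ) (Xi : Fin N → Set X) (hXine : ∀ i, (Xi i).Nonempty)
    (u : Fin N → X → X) (a : ℝ) (ha0 : 0 ≤ a) (ha1 : a < 1)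
    (hulip : ∀ i, ∀ x₁ ∈ Xi i, ∀ x₂ ∈ Xi i, dist (u i x₁) (u i x₂) ≤ a * dist x₁ x₂)
    (v : Fin N → X → Y → Y) (s : ℝ) (hs0 : 0 ≤ s) (hs1 : s < 1)
    (hv2 : ∀ i, ∀ x ∈ Xi i, ∀ y₁ y₂ : Y, dist (v i x y₁) (v i x y₂) ≤ s * dist y₁ y₂)
    (L : ℝ) (hL : 0 < L)
    (hv1 : ∀ i (y : Y), ∀ x₁ ∈ Xi i, ∀ x₂ ∈ Xi i,
      dist (v i x₁ y) (v i x₂ y) ≤ L * dist x₁ x₂)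
    (θ : ℝ) (hθ : θ = (1 - a) / (2 * L))
    (dθ : X × Y → X × Y → ℝ)
    (hdθ : ∀ p q₀ : X × Y, dθ p q₀ = dist p.1 q₀.1 + θ * dist p.2 q₀.2)
    (w : Fin N → X × Y → X × Y)
    (hw : ∀ i (p : X × Y), w i p = (u i p.1, v i p.1 p.2))
    (q : ℝ) (hq : q = max (a + θ * L) s) :
    q < 1 ∧ ∀ i, ∀ p₁ : X × Y, p₁.1 ∈ Xi i → ∀ p₂ : X × Y, p₂.1 ∈ Xi i →
      dθ (w i p₁) (w i p₂) ≤ q * dθ p₁ p₂ := by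
  have hθL : θ * L = (1 - a) / 2 := by
    rw [hθ]; field_simp
  have hθ0 : 0 ≤ θ := by
    rw [hθ]; exact div_nonneg (by linarith) (by linarith)
  have hq1 : a + θ * L ≤ q := hq ▸ le_max_left _ _
  have hq2 : s ≤ q := hq ▸ le_max_right _ _
  refine ⟨?_, ?_⟩
  · rw [hq]
    exact max_lt (by linarith) hs1
  · rintro i ⟨x₁, y₁⟩ h₁ ⟨x₂, y₂⟩ h₂
    rw [hdθ, hdθ, hw, hw]
    simp only at h₁ h₂ ⊢
    have e1 := hulip i x₁ h₁ x₂ h₂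
    have e2 : dist (v i x₁ y₁) (v i x₂ y₂) ≤ s * dist y₁ y₂ + L * dist x₁ x₂ :=
      (dist_triangle _ (v i x₁ y₂) _).trans
        (add_le_add (hv2 i x₁ h₁ y₁ y₂) (hv1 i y₂ x₁ h₁ x₂ h₂))
    have e3 := mul_le_mul_of_nonneg_left e2 hθ0
    have e4 := mul_le_mul_of_nonneg_right hq1 (dist_nonneg (x := x₁) (y := x₂))
    have e5 := mul_le_mul_of_nonneg_right hq2 (mul_nonneg hθ0 (dist_nonneg (x := y₁) (y := y₂)))
    linarith
end

section
/- Let X be a set, X_1,…,X_N subsets of X, and u_i : X_i → X bijections onto their images with the images u_i(X_i) pairwise disjoint and covering X. Let Y be a set, let v_i : X_i × Y → Y, and define w_i : X_i × Y → X × Y by w_i(x,y) := (u_i(x), v_i(x,y)). If f : X → Y satisfies f(u_i(x)) = v_i(x, f(x)) for all x ∈ X_i and all i = 1,…,N, then the graph G(f) := {(x,f(x)) | x ∈ X} satisfies the self-referential equation G(f) = ⋃_{i=1}^N w_i( G(f) ∩ (X_i × Y) ), i.e., G(f) is a local attractor of the local IFS {X×Y; (X_i×Y, w_i)}. -/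
/-- If `f : X → Y` satisfies the fixed point equations `f(uᵢ(x)) = vᵢ(x, f(x))` on `Xᵢ`,
where the images `uᵢ(Xᵢ)` are pairwise disjoint and cover `X`, then the graph of `f` is a
local attractor of the local IFS given by the maps `wᵢ(x,y) = (uᵢ(x), vᵢ(x,y))` on
`Xᵢ × Y`, i.e. `G(f) = ⋃ᵢ wᵢ(G(f) ∩ (Xᵢ × Y))`. -/
theorem stmt9 {X Y : Type*} (N : ℕ) (Xi : Fin N → Set X)
    (u : Fin N → X → X) (huinj : ∀ i, Set.InjOn (u i) (Xi i))
    (hcover : (⋃ i, u i '' Xi i) = Set.univ)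
    (hdisj : ∀ i j, i ≠ j → Disjoint (u i '' Xi i) (u j '' Xi j))
    (v : Fin N → X → Y → Y)
    (w : Fin N → X × Y → X × Y)
    (hw : ∀ i (p : X × Y), w i p = (u i p.1, v i p.1 p.2))
    (f : X → Y) (hfix : ∀ i, ∀ x ∈ Xi i, f (u i x) = v i x (f x)) :
    {p : X × Y | p.2 = f p.1} =
      ⋃ i, w i '' ({p : X × Y | p.2 = f p.1} ∩ (Xi i) ×ˢ (Set.univ : Set Y)) := by
  ext ⟨a, b⟩
  constructor
  · intro h
    have hb : b = f a := h
    have ha : a ∈ ⋃ i, u i '' Xi i := by rw [hcover]; exact Set.mem_univ a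
    obtain ⟨i, x, hx, rfl⟩ := Set.mem_iUnion.1 ha
    refine Set.mem_iUnion.2 ⟨i, (x, f x), ⟨rfl, hx, Set.mem_univ _⟩, ?_⟩
    rw [hw, hb, hfix i x hx]
  · intro h
    obtain ⟨i, ⟨x, y⟩, ⟨hy, hx, _⟩, he⟩ := Set.mem_iUnion.1 h
    have hy' : y = f x := hy
    rw [hw] at he
    have h1 : u i x = a := congrArg Prod.fst he
    have h2 : v i x y = b := congrArg Prod.snd he
    change b = f a
    rw [← h1, ← h2, hfix i x hx, hy']
end

section
/- Let n ∈ ℕ. Let N be an even positive integer, and for j = 1,…,N/2 set X_{2j-1} = X_{2j} = [2(j-1)/N, 2j/N] ⊆ [0,1], with affine maps u_{2j-1}(x) = x/2 + (j-1)/N and u_{2j}(x) = x/2 + j/N, whose images partition [0,1]. Let x_k := k/N, let interpolation vectors y_j^{(n)} = (y_j^{(0)},…,y_j^{(n)}) ∈ ℝ^{n+1} be given for j = 0,…,N/2, and set C^n_{I} := { f ∈ C^n[0,1] : D^k f(x_{2j}) = y_j^{(k)} for all k = 0,…,n and j = 0,…,N/2 }. Suppose λ_i, S_i ∈ C^n(X_i)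 are such that for every f ∈ C^n_{I} the function Φf, defined by Φf(x) := λ_i(u_i^{-1}(x)) + S_i(u_i^{-1}(x))·f(u_i^{-1}(x)) for x ∈ u_i(X_i), satisfies D^k Φf(x_{2(j-1)}) = y_{j-1}^{(k)} and D^k Φf(x_{2j}) = y_j^{(k)} for all k = 0,…,n and j = 1,…,N/2, as well as the join-up conditions D^k Φf(x_{2j-1}−) = D^k Φf(x_{2j-1}+) for all k = 0,…,n and j = 1,…,N/2. Then Φ maps C^n_{I} into itself, satisfies ‖Φf − Φg‖_{C^n} ≤ ( 2^n · max_{1≤i≤N} max_{0≤k≤n} Σ_{l=0}^{k} C(n−k+l, l) · ‖D^l S_i‖_{∞,X_i} ) · ‖f − g‖_{C^n} for all f,g ∈ C^n_{I}, and if 2^n · max_i max_{0≤k≤n} Σ_{l=0}^{k} C(n−k+l, l) ‖D^l S_i‖_{∞,X_i} < 1, then Φ is contractive on C^n_{I} and has a unique fixed point 𝔣 ∈ C^n_{I}. -/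
open Set

/-- The `C^n` distance `‖f - g‖_{C^n} = ∑_{k=0}^n ‖D^k f - D^k g‖_∞` on `[0,1]`. -/
noncomputable def cnDist (n : ℕ) (f g : ℝ → ℝ) : ℝ :=
  ∑ k ∈ Finset.range (n + 1),
    sSup ((fun x => |iteratedDerivWithin k f (Set.Icc (0 : ℝ) 1) x -
      iteratedDerivWithin k g (Set.Icc (0 : ℝ) 1) x|) '' Set.Icc (0 : ℝ) 1)

/-- The sup norm `‖D^l S‖_{∞,A}` of an iterated derivative on a set `A`. -/
noncomputable def supDeriv (l : ℕ) (S : ℝ → ℝ) (A : Set ℝ) : ℝ :=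
  sSup ((fun x => |iteratedDerivWithin l S A x|) '' A)

structure HasJet (n : ℕ) (F : ℕ → ℝ → ℝ) (s : Set ℝ) : Prop where
  der : ∀ k, k < n → ∀ x ∈ s, HasDerivWithinAt (F k) (F (k+1) x) s x
  cont : ContinuousOn (F n) s

lemma HasJet.mono {n : ℕ} {F : ℕ → ℝ → ℝ} {s t : Set ℝ} (h : HasJet n F s) (hts : t ⊆ s) :
    HasJet n F t :=
  ⟨fun k hk x hx => (h.der k hk x (hts hx)).mono hts, h.cont.mono hts⟩

lemma HasJet.contAll {n : ℕ} {F : ℕ → ℝ → ℝ} {s : Set ℝ} (h : HasJet n F s) (k : ℕ) (hk : k ≤ n) :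
    ContinuousOn (F k) s := by
  rcases hk.lt_or_eq with h1 | rfl
  · exact fun x hx => (h.der k h1 x hx).continuousWithinAt
  · exact h.cont

lemma HasJet.eqOn {n : ℕ} {F : ℕ → ℝ → ℝ} {s : Set ℝ} (h : HasJet n F s) (hs : UniqueDiffOn ℝ s) :
    ∀ k, k ≤ n → EqOn (iteratedDerivWithin k (F 0) s) (F k) s := by
  intro k
  induction k with
  | zero => intro _ x _; simp
  | succ k ih =>
    intro hk x hx
    rw [iteratedDerivWithin_succ, derivWithin_congr (ih (by omega)) (ih (by omega) hx)]
    exact (h.der k (by omega) x hx).derivWithin (hs x hx)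

lemma HasJet.contDiffOn {n : ℕ} {F : ℕ → ℝ → ℝ} {s : Set ℝ} (h : HasJet n F s)
    (hs : UniqueDiffOn ℝ s) : ContDiffOn ℝ n (F 0) s := by
  rw [contDiffOn_nat_iff_continuousOn_differentiableOn_deriv hs]
  refine ⟨fun m hm => (h.contAll m hm).congr (h.eqOn hs m hm), fun m hm => ?_⟩
  exact DifferentiableOn.congr (fun x hx => (h.der m hm x hx).differentiableWithinAt)
    (h.eqOn hs m hm.le)

lemma hasJet_of_contDiffOn {n : ℕ} {f : ℝ → ℝ} {s : Set ℝ} (h : ContDiffOn ℝ n f s)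
    (hs : UniqueDiffOn ℝ s) : HasJet n (fun k => iteratedDerivWithin k f s) s := by
  refine ⟨fun k hk x hx => ?_, h.continuousOn_iteratedDerivWithin le_rfl hs⟩
  have := (h.differentiableOn_iteratedDerivWithin (by exact_mod_cast hk) hs x hx).hasDerivWithinAt
  simpa [iteratedDerivWithin_succ] using this

lemma iterDW_subset {n : ℕ} {f : ℝ → ℝ} {s t : Set ℝ} (h : ContDiffOn ℝ n f s)
    (hs : UniqueDiffOn ℝ s) (ht : UniqueDiffOn ℝ t) (hts : t ⊆ s) (k : ℕ) (hk : k ≤ n) :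
    EqOn (iteratedDerivWithin k f t) (iteratedDerivWithin k f s) t := by
  have := ((hasJet_of_contDiffOn h hs).mono hts).eqOn ht k hk
  simpa using this

lemma hasJet_congr {n : ℕ} {F : ℕ → ℝ → ℝ} {s : Set ℝ} (h : HasJet n F s) {f : ℝ → ℝ}
    (hf : EqOn f (F 0) s)
    (hs : UniqueDiffOn ℝ s) : ContDiffOn ℝ n f s ∧
      ∀ k, k ≤ n → EqOn (iteratedDerivWithin k f s) (F k) s :=
  ⟨(h.contDiffOn hs).congr hf, fun k hk x hx => by
    rw [iteratedDerivWithin_congr hf hx, h.eqOn hs k hk hx]⟩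

lemma HasJet.affine {n : ℕ} {F : ℕ → ℝ → ℝ} {s t : Set ℝ} (h : HasJet n F s) (c : ℝ)
    (hts : ∀ x ∈ t, 2 * (x - c) ∈ s) :
    HasJet n (fun k x => 2 ^ k * F k (2 * (x - c))) t := by
  have hm : MapsTo (fun x => 2 * (x - c)) t s := hts
  refine ⟨fun k hk x hx => ?_, ?_⟩
  · have h1 : HasDerivWithinAt (fun x : ℝ => 2 * (x - c)) 2 t x := by
      simpa using (((hasDerivAt_id x).sub_const c).const_mul 2).hasDerivWithinAt
    have h2 := ((h.der k hk _ (hts x hx)).comp x h1 hm).const_mul ((2 : ℝ) ^ k)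
    refine h2.congr_deriv ?_
    ring
  · exact continuousOn_const.mul (h.cont.comp (by fun_prop) hm)

lemma HasJet.glue {n : ℕ} {F Q : ℕ → ℝ → ℝ} {a b c : ℝ} (hab : a ≤ b) (hbc : b ≤ c)
    (hF : HasJet n F (Icc a b)) (hQ : HasJet n Q (Icc b c)) (hm : ∀ k, k ≤ n → F k b = Q k b) :
    HasJet n (fun k x => if x ≤ b then F k x else Q k x) (Icc a c) := by
  have e1 : ∀ k, EqOn (fun x => if x ≤ b then F k x else Q k x) (F k) (Icc a b) := by
    intro k x hx; simp [hx.2]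
  have e2 : ∀ k, k ≤ n → EqOn (fun x => if x ≤ b then F k x else Q k x) (Q k) (Icc b c) := by
    intro k hk x hx
    by_cases h : x ≤ b
    · have : x = b := le_antisymm h hx.1
      subst this; simp [hm k hk]
    · simp [h]
  rw [← Icc_union_Icc_eq_Icc hab hbc]
  refine ⟨fun k hk x hx => ?_, ?_⟩
  · refine HasDerivWithinAt.union ?_ ?_
    · by_cases h : x ∈ Icc a b
      · have := (hF.der k hk x h).congr (e1 k) (e1 k h)
        exact this.congr_deriv (e1 (k+1) h).symm
      · exact HasFDerivWithinAt.of_notMem_closure (by rwa [isClosed_Icc.closure_eq])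
    · by_cases h : x ∈ Icc b c
      · have := (hQ.der k hk x h).congr (e2 k hk.le) (e2 k hk.le h)
        exact this.congr_deriv (e2 (k+1) hk h).symm
      · exact HasFDerivWithinAt.of_notMem_closure (by rwa [isClosed_Icc.closure_eq])
  · exact ((hF.cont.congr (e1 n)).union_of_isClosed (hQ.cont.congr (e2 n le_rfl))
      isClosed_Icc isClosed_Icc)

lemma glueAll (n N : ℕ) (t : ℕ → ℝ) (ht : Monotone t) (Q : ℕ → ℕ → ℝ → ℝ)
    (hQ : ∀ i, i < N → HasJet n (Q i) (Icc (t i) (t (i+1))))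
    (hm : ∀ i, i + 1 < N → ∀ k, k ≤ n → Q i k (t (i+1)) = Q (i+1) k (t (i+1))) (hN : 0 < N) :
    ∃ F, HasJet n F (Icc (t 0) (t N)) ∧
      ∀ i, i < N → ∀ k, k ≤ n → EqOn (F k) (Q i k) (Icc (t i) (t (i+1))) := by
  have key : ∀ m, m + 1 ≤ N → ∃ F, HasJet n F (Icc (t 0) (t (m+1))) ∧
      ∀ i, i ≤ m → ∀ k, k ≤ n → EqOn (F k) (Q i k) (Icc (t i) (t (i+1))) := by
    intro m
    induction m with
    | zero =>
      intro h
      refine ⟨Q 0, hQ 0 h, fun i hi k hk => ?_⟩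
      obtain rfl : i = 0 := by omega
      exact eqOn_refl _ _
    | succ m ih =>
      intro h
      obtain ⟨F, hF, hE⟩ := ih (by omega)
      have hb : ∀ k, k ≤ n → F k (t (m+1)) = Q (m+1) k (t (m+1)) := by
        intro k hk
        rw [hE m le_rfl k hk ⟨ht (by omega), le_rfl⟩]
        exact hm m (by omega) k hk
      refine ⟨_, hF.glue (ht (by omega)) (ht (by omega)) (hQ (m+1) (by omega)) hb, ?_⟩
      intro i hi k hk x hx
      by_cases hxm : x ≤ t (m+1)
      · simp only [hxm, if_true]
        rcases Nat.lt_or_ge m i with h1 | h1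
        · obtain rfl : i = m + 1 := by omega
          have : x = t (m+1) := le_antisymm hxm hx.1
          subst this
          exact hb k hk
        · exact hE i h1 k hk hx
      · simp only [hxm, if_false]
        obtain rfl : i = m + 1 := by
          by_contra hne
          exact hxm (hx.2.trans (ht (by omega)))
        rfl
  obtain ⟨F, hF, hE⟩ := key (N - 1) (by omega)
  rw [Nat.sub_add_cancel hN] at hF
  exact ⟨F, hF, fun i hi => hE i (by omega)⟩

lemma hasDeriv_limit {s : Set ℝ} (hs : Convex ℝ s) (f f' : ℕ → ℝ → ℝ) (g g' : ℝ → ℝ) (b : ℕ → ℝ)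
    (hb : Filter.Tendsto b Filter.atTop (nhds 0))
    (hf : ∀ p, ∀ x ∈ s, HasDerivWithinAt (f p) (f' p x) s x)
    (h0 : ∀ p, ∀ x ∈ s, |f p x - g x| ≤ b p)
    (h1 : ∀ p, ∀ x ∈ s, |f' p x - g' x| ≤ b p) :
    ∀ x ∈ s, HasDerivWithinAt g (g' x) s x := by
  have lim : ∀ x ∈ s, Filter.Tendsto (fun p => f p x) Filter.atTop (nhds (g x)) := by
    intro x hx
    rw [tendsto_iff_norm_sub_tendsto_zero]
    exact squeeze_zero (fun _ => norm_nonneg _) (fun p => h0 p x hx) hb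
  have lip : ∀ p, ∀ x ∈ s, ∀ y ∈ s, |(f p y - g y) - (f p x - g x)| ≤ b p * |y - x| := by
    intro p x hx y hy
    have e : ∀ q, |(f p y - f q y) - (f p x - f q x)| ≤ (b p + b q) * |y - x| := by
      intro q
      refine hs.norm_image_sub_le_of_norm_hasDerivWithin_le (f := fun y => f p y - f q y)
        (f' := fun y => f' p y - f' q y)
        (fun z hz => (hf p z hz).sub (hf q z hz)) ?_ hx hy
      intro z hz
      have := h1 p z hz
      have := h1 q z hz
      rw [Real.norm_eq_abs]
      rw [abs_le] at *
      constructor <;> linarith [this.1, this.2]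
    refine le_of_tendsto_of_tendsto' (f := fun q => |(f p y - f q y) - (f p x - f q x)|)
      (g := fun q => (b p + b q) * |y - x|) (b := Filter.atTop) ?_ ?_ e
    · exact ((tendsto_const_nhds.sub (lim y hy)).sub (tendsto_const_nhds.sub (lim x hx))).abs
    · simpa using (tendsto_const_nhds.add hb).mul_const (|y - x|)
  intro x hx
  rw [hasDerivWithinAt_iff_isLittleO, Asymptotics.isLittleO_iff]
  intro c hc
  obtain ⟨p, hp⟩ := (hb.eventually (gt_mem_nhds (show (0 : ℝ) < c / 3 by positivity))).exists
  have := (hasDerivWithinAt_iff_isLittleO.1 (hf p x hx))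
  rw [Asymptotics.isLittleO_iff] at this
  filter_upwards [this (show (0 : ℝ) < c / 3 by positivity), self_mem_nhdsWithin] with y hy hys
  simp only [Real.norm_eq_abs, smul_eq_mul] at *
  have a1 := lip p x hx y hys
  have a2 : |(f' p x - g' x) * (y - x)| ≤ b p * |y - x| := by
    rw [abs_mul]; gcongr; exact h1 p x hx
  have a3 : b p * |y - x| ≤ c / 3 * |y - x| := by gcongr
  rw [show g y - g x - (y - x) * g' x = -((f p y - g y) - (f p x - g x)) +
    (f p y - f p x - (y - x) * f' p x) + (f' p x - g' x) * (y - x) by ring]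
  refine (abs_add_three _ _ _).trans ?_
  rw [abs_neg]
  linarith

lemma sum_le_next (n : ℕ) (h : ℕ → ℝ) (h0 : ∀ m, 0 ≤ h m) (hh : ∀ m, m < n → h m ≤ h (m+1) / 2)
    (k : ℕ) (hk : k ≤ n) : ∑ m ∈ Finset.range k, h m ≤ h k := by
  induction k with
  | zero => simpa using h0 0
  | succ k ih =>
    rw [Finset.sum_range_succ]
    linarith [ih (by omega), hh k (by omega)]

lemma comb_bound (n : ℕ) (s h : ℕ → ℝ) (σ : ℝ) (hs : ∀ l, 0 ≤ s l) (h0 : ∀ m, 0 ≤ h m)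
    (hh : ∀ m, m < n → h m ≤ h (m+1) / 2)
    (hσ : ∀ k, k ≤ n → ∑ l ∈ Finset.range (k + 1), (Nat.choose (n - k + l) l : ℝ) * s l ≤ σ)
    (k : ℕ) (hk : k ≤ n) :
    ∑ l ∈ Finset.range (k + 1), (Nat.choose k l : ℝ) * s l * h (k - l) ≤ σ * h k := by
  have hs0 : s 0 ≤ σ := by simpa using hσ 0 (Nat.zero_le _)
  have hl : ∀ l, l + 1 ≤ n → (Nat.choose n (l+1) : ℝ) * s (l+1) ≤ σ - s 0 := by
    intro l hl
    have := hσ (l+1) hl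
    rw [Finset.sum_range_succ, Finset.sum_range_succ'] at this
    have h3 : 0 ≤ ∑ k ∈ Finset.range l, (Nat.choose (n - (l+1) + (k+1)) (k+1) : ℝ) * s (k+1) :=
      Finset.sum_nonneg fun i _ => mul_nonneg (Nat.cast_nonneg _) (hs _)
    rw [Nat.sub_add_cancel hl] at this
    simp only [Nat.choose_zero_right, Nat.cast_one, one_mul] at this
    linarith
  rw [Finset.sum_range_succ']
  have h1 : ∑ l ∈ Finset.range k, (Nat.choose k (l+1) : ℝ) * s (l+1) * h (k - (l+1)) ≤
      ∑ l ∈ Finset.range k, (σ - s 0) * h (k - 1 - l) := by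
    refine Finset.sum_le_sum fun l hlk => ?_
    rw [Finset.mem_range] at hlk
    rw [show k - (l+1) = k - 1 - l by omega]
    refine mul_le_mul_of_nonneg_right ?_ (h0 _)
    refine le_trans ?_ (hl l (by omega))
    refine mul_le_mul_of_nonneg_right ?_ (hs _)
    exact_mod_cast Nat.choose_le_choose _ hk
  rw [← Finset.mul_sum, Finset.sum_range_reflect] at h1
  have h2 := mul_le_mul_of_nonneg_left (sum_le_next n h h0 hh k hk) (sub_nonneg.2 hs0)
  simp only [Nat.choose_zero_right, Nat.cast_one, one_mul, Nat.sub_zero]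
  linarith

lemma taylor_ex (n : ℕ) (a : ℝ) (y : ℕ → ℝ) : ∃ P : Polynomial ℝ,
    ∀ k, k ≤ n → (Polynomial.derivative^[k] P).eval a = y k := by
  refine ⟨∑ m ∈ Finset.range (n+1), Polynomial.C (y m / m.factorial) *
    (Polynomial.X - Polynomial.C a) ^ m, fun k hk => ?_⟩
  rw [Polynomial.iterate_derivative_sum, Polynomial.eval_finsetSum,
    Finset.sum_eq_single_of_mem k (by simp; omega)]
  · rw [Polynomial.iterate_derivative_C_mul, Polynomial.iterate_derivative_X_sub_pow_self]
    simp
    field_simp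
  · intro m _ hm
    rw [Polynomial.iterate_derivative_C_mul, Polynomial.iterate_derivative_X_sub_pow]
    rcases lt_or_gt_of_ne hm with h | h
    · rw [Nat.descFactorial_of_lt h]; simp
    · simp [show m - k ≠ 0 by omega]

lemma poly_iter (P : Polynomial ℝ) (s : Set ℝ) (hs : UniqueDiffOn ℝ s) (k : ℕ) (x : ℝ) (hx : x ∈ s) :
    iteratedDerivWithin k (fun x => P.eval x) s x = (Polynomial.derivative^[k] P).eval x := by
  have h : HasJet k (fun k x => (Polynomial.derivative^[k] P).eval x) s := by
    refine ⟨fun m _ x _ => ?_, (Polynomial.continuous _).continuousOn⟩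
    rw [Function.iterate_succ_apply']
    exact (Polynomial.hasDerivAt _ _).hasDerivWithinAt
  exact h.eqOn hs k le_rfl hx

lemma hermite_ex (n M : ℕ) (a : ℕ → ℝ) (δ : ℝ) (hδ : 0 < δ)
    (ha : ∀ i j, i ≠ j → δ ≤ |a i - a j|) (y : ℕ → ℕ → ℝ) (s : Set ℝ) (hs : UniqueDiffOn ℝ s)
    (has : ∀ j, j ≤ M → a j ∈ s) :
    ∃ f : ℝ → ℝ, ContDiffOn ℝ n f s ∧
      ∀ j, j ≤ M → ∀ k, k ≤ n → iteratedDerivWithin k f s (a j) = y j k := by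
  choose P hP using fun j => taylor_ex n (a j) (y j)
  let b : ∀ j, ContDiffBump (a j) := fun j => ⟨δ/3, δ/2, by positivity, by linarith⟩
  refine ⟨fun x => ∑ j ∈ Finset.range (M+1), b j x * (P j).eval x, ?_, ?_⟩
  · refine ContDiff.contDiffOn (ContDiff.sum fun j _ => ?_)
    exact (b j).contDiff.mul (by simpa using Polynomial.contDiff_aeval (R := ℝ) (𝕜 := ℝ) (P j) n)
  · intro j hj k hk
    have hev : (fun x => ∑ j ∈ Finset.range (M+1), b j x * (P j).eval x) =ᶠ[nhds (a j)]
        (fun x => (P j).eval x) := by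
      filter_upwards [Metric.closedBall_mem_nhds (a j) (show 0 < δ/3 by positivity)] with x hx
      rw [Finset.sum_eq_single_of_mem j (by simp; omega)]
      · rw [(b j).one_of_mem_closedBall hx, one_mul]
      · intro i _ hij
        rw [(b i).zero_of_le_dist, zero_mul]
        show δ / 2 ≤ dist x (a i)
        have h1 := ha i j hij
        rw [← Real.dist_eq] at h1
        have h2 := dist_triangle_left (a i) (a j) x
        rw [Metric.mem_closedBall] at hx
        linarith
    rw [(hev.filter_mono nhdsWithin_le_nhds).iteratedDerivWithin_eq hev.self_of_nhds,
      poly_iter _ _ hs _ _ (has j hj), hP j k hk]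

/-- sup of `|D^k f - D^k g|`. -/
noncomputable def dK (f g : ℝ → ℝ) (k : ℕ) : ℝ :=
  sSup ((fun x => |iteratedDerivWithin k f (Set.Icc (0 : ℝ) 1) x -
      iteratedDerivWithin k g (Set.Icc (0 : ℝ) 1) x|) '' Set.Icc (0 : ℝ) 1)

lemma uI : UniqueDiffOn ℝ (Icc (0:ℝ) 1) := uniqueDiffOn_Icc one_pos

lemma dK_nonneg (f g : ℝ → ℝ) (k : ℕ) : 0 ≤ dK f g k := by
  refine Real.sSup_nonneg ?_
  rintro _ ⟨x, _, rfl⟩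
  exact abs_nonneg _

lemma dK_le (f g : ℝ → ℝ) (k : ℕ) (c : ℝ) (h : ∀ x ∈ Icc (0:ℝ) 1,
    |iteratedDerivWithin k f (Set.Icc (0 : ℝ) 1) x -
      iteratedDerivWithin k g (Set.Icc (0 : ℝ) 1) x| ≤ c) : dK f g k ≤ c := by
  refine csSup_le ⟨_, mem_image_of_mem _ (show (0:ℝ) ∈ Icc (0:ℝ) 1 by simp)⟩ ?_
  rintro _ ⟨x, hx, rfl⟩
  exact h x hx

lemma le_dK {n : ℕ} {f g : ℝ → ℝ} (hf : ContDiffOn ℝ n f (Icc 0 1))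
    (hg : ContDiffOn ℝ n g (Icc 0 1)) {k : ℕ} (hk : k ≤ n) {x : ℝ} (hx : x ∈ Icc (0:ℝ) 1) :
    |iteratedDerivWithin k f (Set.Icc (0 : ℝ) 1) x -
      iteratedDerivWithin k g (Set.Icc (0 : ℝ) 1) x| ≤ dK f g k := by
  refine le_csSup ?_ (mem_image_of_mem _ hx)
  refine isCompact_Icc.bddAbove_image ?_
  exact (((hasJet_of_contDiffOn hf uI).contAll k hk).sub
    ((hasJet_of_contDiffOn hg uI).contAll k hk)).abs

lemma le_supDeriv {n : ℕ} {f : ℝ → ℝ} {a b : ℝ} (hab : a < b) (hf : ContDiffOn ℝ n f (Icc a b))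
    {k : ℕ} (hk : k ≤ n) {x : ℝ} (hx : x ∈ Icc a b) :
    |iteratedDerivWithin k f (Icc a b) x| ≤ supDeriv k f (Icc a b) := by
  refine le_csSup ?_ (mem_image_of_mem _ hx)
  refine isCompact_Icc.bddAbove_image ?_
  exact ((hasJet_of_contDiffOn hf (uniqueDiffOn_Icc hab)).contAll k hk).abs

lemma supDeriv_nonneg (k : ℕ) (f : ℝ → ℝ) (A : Set ℝ) : 0 ≤ supDeriv k f A := by
  refine Real.sSup_nonneg ?_
  rintro _ ⟨x, _, rfl⟩
  exact abs_nonneg _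

lemma dK_half {n : ℕ} {f g : ℝ → ℝ} (hf : ContDiffOn ℝ n f (Icc 0 1))
    (hg : ContDiffOn ℝ n g (Icc 0 1)) {k : ℕ} (hk : k < n)
    (h0 : iteratedDerivWithin k f (Set.Icc (0 : ℝ) 1) 0 = iteratedDerivWithin k g (Set.Icc (0 : ℝ) 1) 0)
    (h1 : iteratedDerivWithin k f (Set.Icc (0 : ℝ) 1) 1 = iteratedDerivWithin k g (Set.Icc (0 : ℝ) 1) 1) :
    dK f g k ≤ dK f g (k+1) / 2 := by
  refine dK_le _ _ _ _ fun x hx => ?_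
  have key : ∀ z ∈ Icc (0:ℝ) 1, iteratedDerivWithin k f (Set.Icc (0 : ℝ) 1) z =
      iteratedDerivWithin k g (Set.Icc (0 : ℝ) 1) z →
      |iteratedDerivWithin k f (Set.Icc (0 : ℝ) 1) x -
      iteratedDerivWithin k g (Set.Icc (0 : ℝ) 1) x| ≤ dK f g (k+1) * |x - z| := by
    intro z hz he
    have := (convex_Icc (0:ℝ) 1).norm_image_sub_le_of_norm_hasDerivWithin_le
      (fun y hy => ((hasJet_of_contDiffOn hf uI).der k hk y hy).sub
        ((hasJet_of_contDiffOn hg uI).der k hk y hy))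
      (C := dK f g (k+1)) (fun y hy => le_dK hf hg hk hy) hz hx
    simpa [he] using this
  have hd := dK_nonneg f g (k+1)
  rcases le_total x (1/2) with h | h
  · have := key 0 (by simp) h0
    rw [sub_zero, abs_of_nonneg hx.1] at this
    nlinarith
  · have := key 1 (by simp) h1
    rw [abs_of_nonpos (show x - 1 ≤ 0 by linarith [hx.2])] at this
    nlinarith

lemma piece_bound {n : ℕ} {f g S : ℝ → ℝ} {a b : ℝ} (hab : a < b) (ha : 0 ≤ a) (hb : b ≤ 1)
    (hf : ContDiffOn ℝ n f (Icc 0 1))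
    (hg : ContDiffOn ℝ n g (Icc 0 1)) (hS : ContDiffOn ℝ n S (Icc a b)) (σ : ℝ)
    (hh : ∀ m, m < n → dK f g m ≤ dK f g (m+1) / 2)
    (hσ : ∀ k, k ≤ n → ∑ l ∈ Finset.range (k + 1),
      (Nat.choose (n - k + l) l : ℝ) * supDeriv l S (Icc a b) ≤ σ)
    (k : ℕ) (hk : k ≤ n) (x : ℝ) (hx : x ∈ Icc a b) :
    |iteratedDerivWithin k (S * (f - g)) (Icc a b) x| ≤ σ * dK f g k := by
  have u := uniqueDiffOn_Icc hab
  have hsub : Icc a b ⊆ Icc (0:ℝ) 1 := Icc_subset_Icc ha hb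
  have hfg : ContDiffOn ℝ n (f - g) (Icc a b) := (hf.sub hg).mono hsub
  have hk' : (k : WithTop ℕ∞) ≤ n := by exact_mod_cast hk
  rw [iteratedDerivWithin_mul hx u ((hS x hx).of_le hk') ((hfg x hx).of_le hk')]
  refine (Finset.abs_sum_le_sum_abs _ _).trans ?_
  refine le_trans ?_ (comb_bound n (fun l => supDeriv l S (Icc a b)) (dK f g) σ
    (fun l => supDeriv_nonneg _ _ _) (dK_nonneg f g) hh hσ k hk)
  refine Finset.sum_le_sum fun l hl => ?_
  rw [Finset.mem_range] at hl
  rw [abs_mul, abs_mul, Nat.abs_cast]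
  have h1 := le_supDeriv hab hS (show l ≤ n by omega) hx
  have h2 : |iteratedDerivWithin (k - l) (f - g) (Icc a b) x| ≤ dK f g (k - l) := by
    rw [iterDW_subset (f := f - g) (hf.sub hg) uI u hsub (k-l) (by omega) hx]
    have hk2 : ((k - l : ℕ) : WithTop ℕ∞) ≤ n := by exact_mod_cast (show k - l ≤ n by omega)
    rw [iteratedDerivWithin_sub (hsub hx) uI ((hf x (hsub hx)).of_le hk2)
      ((hg x (hsub hx)).of_le hk2)]
    exact le_dK hf hg (by omega) (hsub hx)
  have := supDeriv_nonneg l S (Icc a b)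
  gcongr

lemma fix_ex (n M : ℕ) (a : ℕ → ℝ) (has : ∀ j, j ≤ M → a j ∈ Icc (0:ℝ) 1) (y : ℕ → ℕ → ℝ)
    (CnI : (ℝ → ℝ) → Prop)
    (hCnI : ∀ f : ℝ → ℝ, CnI f ↔ (ContDiffOn ℝ n f (Icc 0 1) ∧
      ∀ j, j ≤ M → ∀ k, k ≤ n → iteratedDerivWithin k f (Icc 0 1) (a j) = y j k))
    (Φ : (ℝ → ℝ) → (ℝ → ℝ)) (hmap : ∀ f, CnI f → CnI (Φ f)) (c : ℝ) (hc0 : 0 ≤ c) (hc1 : c < 1)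
    (hcon : ∀ f g, CnI f → CnI g → ∀ k, k ≤ n → dK (Φ f) (Φ g) k ≤ c * dK f g k)
    (f₀ : ℝ → ℝ) (hf₀ : CnI f₀) :
    ∃ 𝔣, CnI 𝔣 ∧ Set.EqOn (Φ 𝔣) 𝔣 (Icc 0 1) ∧
        ∀ g, CnI g → Set.EqOn (Φ g) g (Icc 0 1) → Set.EqOn g 𝔣 (Icc 0 1) := by
  have hcd : ∀ f, CnI f → ContDiffOn ℝ n f (Icc 0 1) := fun f hf => ((hCnI f).1 hf).1
  let fs : ℕ → ℝ → ℝ := fun p => Φ^[p] f₀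
  have hfs1 : ∀ p, fs (p+1) = Φ (fs p) := fun p => Function.iterate_succ_apply' _ _ _
  have hfs : ∀ p, CnI (fs p) := by
    intro p
    induction p with
    | zero => exact hf₀
    | succ p ih => rw [hfs1]; exact hmap _ ih
  let B : ℝ := ∑ k ∈ Finset.range (n+1), dK (fs 0) (fs 1) k
  have hgeo : ∀ k, k ≤ n → ∀ p, dK (fs p) (fs (p+1)) k ≤ B * c ^ p := by
    intro k hk p
    induction p with
    | zero =>
      simp only [pow_zero, mul_one]
      exact Finset.single_le_sum (f := fun k => dK (fs 0) (fs 1) k)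
        (fun i _ => dK_nonneg _ _ _) (by simp; omega)
    | succ p ih =>
      rw [hfs1 p, hfs1 (p+1)]
      refine (hcon _ _ (hfs p) (hfs (p+1)) k hk).trans ?_
      rw [pow_succ]
      nlinarith
  have hdist : ∀ k, k ≤ n → ∀ x ∈ Icc (0:ℝ) 1, ∀ p,
      dist (iteratedDerivWithin k (fs p) (Icc 0 1) x)
        (iteratedDerivWithin k (fs (p+1)) (Icc 0 1) x) ≤ B * c ^ p := fun k hk x hx p =>
    (le_dK (hcd _ (hfs p)) (hcd _ (hfs (p+1))) hk hx).trans (hgeo k hk p)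
  have hex : ∀ k x, ∃ z, k ≤ n → x ∈ Icc (0:ℝ) 1 → Filter.Tendsto
      (fun p => iteratedDerivWithin k (fs p) (Icc 0 1) x) Filter.atTop (nhds z) := by
    intro k x
    by_cases h : k ≤ n ∧ x ∈ Icc (0:ℝ) 1
    · obtain ⟨z, hz⟩ := cauchySeq_tendsto_of_complete
        (cauchySeq_of_le_geometric c B hc1 (hdist k h.1 x h.2))
      exact ⟨z, fun _ _ => hz⟩
    · exact ⟨0, fun h1 h2 => absurd ⟨h1, h2⟩ h⟩
  choose F hF using hex
  let b : ℕ → ℝ := fun p => B * c ^ p / (1 - c)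
  have hb : Filter.Tendsto b Filter.atTop (nhds 0) := by
    simpa using ((tendsto_pow_atTop_nhds_zero_of_lt_one hc0 hc1).const_mul B).div_const (1 - c)
  have hbd : ∀ k, k ≤ n → ∀ p, ∀ x ∈ Icc (0:ℝ) 1,
      |iteratedDerivWithin k (fs p) (Icc 0 1) x - F k x| ≤ b p := fun k hk p x hx =>
    dist_le_of_le_geometric_of_tendsto c B hc1 (hdist k hk x hx) (hF k x hk hx) p
  have hjet : HasJet n F (Icc 0 1) := by
    refine ⟨fun k hk => ?_, ?_⟩
    · refine hasDeriv_limit (convex_Icc _ _) (fun p => iteratedDerivWithin k (fs p) (Icc 0 1))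
        (fun p => iteratedDerivWithin (k+1) (fs p) (Icc 0 1)) (F k) (F (k+1)) b hb ?_ ?_ ?_
      · exact fun p x hx => (hasJet_of_contDiffOn (hcd _ (hfs p)) uI).der k hk x hx
      · exact hbd k hk.le
      · exact hbd (k+1) hk
    · have hu : TendstoUniformlyOn (fun p => iteratedDerivWithin n (fs p) (Icc 0 1)) (F n)
          Filter.atTop (Icc 0 1) := by
        rw [Metric.tendstoUniformlyOn_iff]
        intro ε hε
        filter_upwards [hb.eventually (gt_mem_nhds hε)] with p hp x hx
        rw [dist_comm]
        exact (hbd n le_rfl p x hx).trans_lt hp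
      refine hu.continuousOn (Filter.Eventually.frequently (Filter.Eventually.of_forall fun p => ?_))
      exact (hasJet_of_contDiffOn (hcd _ (hfs p)) uI).cont
  have hFC : CnI (F 0) := by
    rw [hCnI]
    refine ⟨hjet.contDiffOn uI, fun j hj k hk => ?_⟩
    rw [hjet.eqOn uI k hk (has j hj)]
    refine tendsto_nhds_unique (hF k (a j) hk (has j hj)) ?_
    have : (fun p => iteratedDerivWithin k (fs p) (Icc 0 1) (a j)) = fun _ => y j k :=
      funext fun p => ((hCnI _).1 (hfs p)).2 j hj k hk
    rw [this]
    exact tendsto_const_nhds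
  have hfix : Set.EqOn (Φ (F 0)) (F 0) (Icc 0 1) := by
    intro x hx
    have h1 : ∀ p, |Φ (F 0) x - F 0 x| ≤ c * b p + b (p+1) := by
      intro p
      have e1 := le_dK (hcd _ (hmap _ (hfs p))) (hcd _ (hmap _ hFC)) (Nat.zero_le n) hx
      have e2 := hcon _ _ (hfs p) hFC 0 (Nat.zero_le _)
      have e3 : dK (fs p) (F 0) 0 ≤ b p := by
        refine dK_le _ _ _ _ fun z hz => ?_
        have := hbd 0 (Nat.zero_le _) p z hz
        simpa using this
      have e4 := hbd 0 (Nat.zero_le _) (p+1) x hx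
      rw [hfs1] at e4
      simp only [iteratedDerivWithin_zero] at e1 e4
      have e5 := abs_sub_le (Φ (F 0) x) (Φ (fs p) x) (F 0 x)
      rw [abs_sub_comm (Φ (F 0) x) (Φ (fs p) x)] at e5
      have e6 := mul_le_mul_of_nonneg_left e3 hc0
      linarith
    have h2 : Filter.Tendsto (fun p => c * b p + b (p+1)) Filter.atTop (nhds 0) := by
      simpa using (hb.const_mul c).add (hb.comp (Filter.tendsto_add_atTop_nat 1))
    have h3 := ge_of_tendsto' h2 h1
    exact sub_eq_zero.1 (abs_eq_zero.1 (le_antisymm h3 (abs_nonneg _)))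
  refine ⟨F 0, hFC, hfix, fun g hg hgf x hx => ?_⟩
  · have h1 : dK g (F 0) 0 ≤ c * dK g (F 0) 0 := by
      refine le_trans (dK_le _ _ _ _ fun z hz => ?_) (hcon _ _ hg hFC 0 (Nat.zero_le _))
      have := le_dK (hcd _ (hmap _ hg)) (hcd _ (hmap _ hFC)) (Nat.zero_le n) hz
      simp only [iteratedDerivWithin_zero] at this ⊢
      rwa [hgf hz, hfix hz] at this
    have h2 := dK_nonneg g (F 0) 0
    have h3 : dK g (F 0) 0 ≤ 0 := by nlinarith
    have h4 := le_dK (hcd _ hg) (hcd _ hFC) (Nat.zero_le n) hx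
    simp only [iteratedDerivWithin_zero] at h4
    exact sub_eq_zero.1 (abs_eq_zero.1 (le_antisymm (h4.trans h3) (abs_nonneg _)))

lemma covJ (N : ℕ) (hN : 0 < N) (xk : ℕ → ℝ) (hx0 : xk 0 = 0) (hxN : xk N = 1)
    (Jset : ℕ → Set ℝ) (hJset : ∀ i, Jset i = Icc (xk (i - 1)) (xk i)) :
    ∀ x ∈ Icc (0:ℝ) 1, ∃ i, 1 ≤ i ∧ i ≤ N ∧ x ∈ Jset i := by
  intro x hx
  have key : ∀ m, m + 1 ≤ N → x ≤ xk (m+1) → ∃ i, 1 ≤ i ∧ i ≤ N ∧ x ∈ Jset i := by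
    intro m
    induction m with
    | zero => exact fun h1 h2 => ⟨1, le_rfl, hN, by rw [hJset]; exact ⟨by simpa [hx0] using hx.1, h2⟩⟩
    | succ m ih =>
      intro h1 h2
      rcases le_total x (xk (m+1)) with h | h
      · exact ih (by omega) h
      · exact ⟨m+2, by omega, h1, by rw [hJset]; exact ⟨h, h2⟩⟩
  refine key (N - 1) (by omega) ?_
  rw [Nat.sub_add_cancel hN, hxN]
  exact hx.2

/-- Smooth local fractal functions of class `C^n` for the binary partition: if the data
`λᵢ, Sᵢ ∈ C^n(Xᵢ)` are such that for every `f ∈ C^n_I` the piecewise defined function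
`Φf` satisfies the `C^n`-interpolation and join-up conditions at the knots, then `Φ`
maps `C^n_I` into itself, satisfies
`‖Φf - Φg‖_{C^n} ≤ 2ⁿ maxᵢ max_k ∑_{l≤k} C(n-k+l,l)‖DˡSᵢ‖_∞ ‖f - g‖_{C^n}`, and if this
constant is `< 1` it is contractive with a unique fixed point in `C^n_I`. -/
theorem stmt16 (n : ℕ) (M : ℕ) (hM : 0 < M) (N : ℕ) (hNM : N = 2 * M)
    (xk : ℕ → ℝ) (hxk : ∀ k, xk k = (k : ℝ) / (N : ℝ))
    (Xi : ℕ → Set ℝ)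
    (hXi : ∀ i, 1 ≤ i → i ≤ N →
      Xi i = Icc (xk (2 * ((i + 1) / 2) - 2)) (xk (2 * ((i + 1) / 2))))
    (u : ℕ → ℝ → ℝ) (hu : ∀ i x, u i x = x / 2 + ((i / 2 : ℕ) : ℝ) / (N : ℝ))
    (Jset : ℕ → Set ℝ) (hJset : ∀ i, Jset i = Icc (xk (i - 1)) (xk i))
    (yv : ℕ → ℕ → ℝ)
    (lam S : ℕ → ℝ → ℝ)
    (hlamC : ∀ i, 1 ≤ i → i ≤ N → ContDiffOn ℝ n (lam i) (Xi i))
    (hSC : ∀ i, 1 ≤ i → i ≤ N → ContDiffOn ℝ n (S i) (Xi i))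
    -- the space `C^n_I`
    (CnI : (ℝ → ℝ) → Prop)
    (hCnI : ∀ f : ℝ → ℝ, CnI f ↔ (ContDiffOn ℝ n f (Icc 0 1) ∧
      ∀ j, j ≤ M → ∀ k, k ≤ n → iteratedDerivWithin k f (Icc 0 1) (xk (2 * j)) = yv j k))
    -- the pieces `G i f = λᵢ ∘ uᵢ⁻¹ + (Sᵢ ∘ uᵢ⁻¹) · (f ∘ uᵢ⁻¹)`
    (G : ℕ → (ℝ → ℝ) → (ℝ → ℝ))
    (hG : ∀ i f x, G i f x = lam i (2 * (x - ((i / 2 : ℕ) : ℝ) / (N : ℝ))) +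
      S i (2 * (x - ((i / 2 : ℕ) : ℝ) / (N : ℝ))) * f (2 * (x - ((i / 2 : ℕ) : ℝ) / (N : ℝ))))
    -- interpolation conditions and `C^n` join-up conditions for `Φf`, `f ∈ C^n_I`
    (hinterp : ∀ f, CnI f → ∀ k, k ≤ n → ∀ j, 1 ≤ j → j ≤ M →
      iteratedDerivWithin k (G (2 * j - 1) f) (Jset (2 * j - 1)) (xk (2 * j - 2)) =
        yv (j - 1) k ∧
      iteratedDerivWithin k (G (2 * j) f) (Jset (2 * j)) (xk (2 * j)) = yv j k)
    (hjoin : ∀ f, CnI f → ∀ k, k ≤ n → ∀ j, 1 ≤ j → j ≤ M →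
      iteratedDerivWithin k (G (2 * j - 1) f) (Jset (2 * j - 1)) (xk (2 * j - 1)) =
        iteratedDerivWithin k (G (2 * j) f) (Jset (2 * j)) (xk (2 * j - 1)))
    (Φ : (ℝ → ℝ) → (ℝ → ℝ))
    (hΦ : ∀ f, CnI f → ∀ i, 1 ≤ i → i ≤ N → ∀ x ∈ Jset i, Φ f x = G i f x)
    (σ : ℝ) (hσ0 : 0 ≤ σ)
    (hσ : ∀ i, 1 ≤ i → i ≤ N → ∀ k, k ≤ n →
      (∑ l ∈ Finset.range (k + 1),
        (Nat.choose (n - k + l) l : ℝ) * supDeriv l (S i) (Xi i)) ≤ σ) :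
    (∀ f, CnI f → CnI (Φ f)) ∧
    (∀ f g, CnI f → CnI g → cnDist n (Φ f) (Φ g) ≤ 2 ^ n * σ * cnDist n f g) ∧
    ((2 : ℝ) ^ n * σ < 1 →
      ∃ 𝔣, CnI 𝔣 ∧ Set.EqOn (Φ 𝔣) 𝔣 (Icc 0 1) ∧
        ∀ g, CnI g → Set.EqOn (Φ g) g (Icc 0 1) → Set.EqOn g 𝔣 (Icc 0 1)) := by
  
  have hNpos : (0:ℝ) < N := by
    have : 0 < N := by omega
    exact_mod_cast this
  have hxs : StrictMono xk := by
    intro p q hpq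
    rw [hxk, hxk]
    have : (p:ℝ) < q := by exact_mod_cast hpq
    gcongr
  have hx0 : xk 0 = 0 := by simp [hxk]
  have hxN : xk N = 1 := by rw [hxk]; field_simp
  have hJu : ∀ i, 1 ≤ i → UniqueDiffOn ℝ (Jset i) := by
    intro i hi
    rw [hJset]
    exact uniqueDiffOn_Icc (hxs (by omega))
  have hmapX : ∀ i, 1 ≤ i → i ≤ N → ∀ x ∈ Jset i,
      2 * (x - ((i / 2 : ℕ) : ℝ) / (N : ℝ)) ∈ Xi i := by
    intro i hi hiN x hx
    rw [hXi i hi hiN, hxk, hxk]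
    rw [hJset, hxk, hxk] at hx
    obtain ⟨q, hq⟩ : ∃ q, i = 2 * q + 1 ∨ i = 2 * q + 2 := ⟨(i-1)/2, by omega⟩
    rcases hq with rfl | rfl
    · rw [show (2 * q + 1) / 2 = q by omega, show 2 * ((2 * q + 1 + 1) / 2) - 2 = 2 * q by omega,
        show 2 * ((2 * q + 1 + 1) / 2) = 2 * q + 2 by omega]
      rw [show 2 * q + 1 - 1 = 2 * q by omega] at hx
      obtain ⟨h1, h2⟩ := hx
      push_cast at *
      rw [div_le_iff₀ hNpos] at h1
      rw [le_div_iff₀ hNpos] at h2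
      have e : 2 * (x - (q:ℝ) / N) = (2 * (x * N) - 2 * q) / N := by field_simp
      rw [e]
      constructor
      · gcongr; linarith
      · gcongr; linarith
    · rw [show (2 * q + 2) / 2 = q + 1 by omega, show 2 * ((2 * q + 2 + 1) / 2) - 2 = 2 * q by omega,
        show 2 * ((2 * q + 2 + 1) / 2) = 2 * q + 2 by omega]
      rw [show 2 * q + 2 - 1 = 2 * q + 1 by omega] at hx
      obtain ⟨h1, h2⟩ := hx
      push_cast at *
      rw [div_le_iff₀ hNpos] at h1
      rw [le_div_iff₀ hNpos] at h2
      have e : 2 * (x - ((q:ℝ) + 1) / N) = (2 * (x * N) - 2 * (q + 1)) / N := by field_simp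
      rw [e]
      constructor
      · gcongr; linarith
      · gcongr; linarith
  have hXab : ∀ i, 1 ≤ i → i ≤ N → ∃ a b : ℝ, Xi i = Icc a b ∧ a < b ∧ 0 ≤ a ∧ b ≤ 1 := by
    intro i hi hiN
    refine ⟨_, _, hXi i hi hiN, hxs (by omega), ?_, ?_⟩
    · rw [← hx0]; exact hxs.monotone (by omega)
    · rw [← hxN]; exact hxs.monotone (by omega)
  have hXsub : ∀ i, 1 ≤ i → i ≤ N → Xi i ⊆ Icc 0 1 := by
    intro i hi hiN
    obtain ⟨a, b, h, _, h1, h2⟩ := hXab i hi hiN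
    rw [h]; exact Icc_subset_Icc h1 h2
  have hcd : ∀ f, CnI f → ContDiffOn ℝ n f (Icc 0 1) := fun f hf => ((hCnI f).1 hf).1
  have hGC : ∀ f, CnI f → ∀ i, 1 ≤ i → i ≤ N → ContDiffOn ℝ n (G i f) (Jset i) := by
    intro f hf i hi hiN
    have hm : MapsTo (fun x : ℝ => 2 * (x - ((i / 2 : ℕ) : ℝ) / (N : ℝ))) (Jset i) (Xi i) :=
      hmapX i hi hiN
    have ha : ContDiffOn ℝ n (fun x : ℝ => 2 * (x - ((i / 2 : ℕ) : ℝ) / (N : ℝ))) (Jset i) := by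
      fun_prop
    have h1 := (hlamC i hi hiN).comp ha hm
    have h2 := (hSC i hi hiN).comp ha hm
    have h3 := ((hcd f hf).mono (hXsub i hi hiN)).comp ha hm
    refine (h1.add (h2.mul h3)).congr fun x _ => ?_
    rw [hG]; rfl
  have hglue : ∀ f, CnI f → ContDiffOn ℝ n (Φ f) (Icc 0 1) ∧ ∀ i, 1 ≤ i → i ≤ N → ∀ k, k ≤ n →
      EqOn (iteratedDerivWithin k (Φ f) (Icc 0 1)) (iteratedDerivWithin k (G i f) (Jset i))
        (Jset i) := by
    intro f hf
    obtain ⟨F, hF, hE⟩ := glueAll n N xk hxs.monotone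
      (fun i k => iteratedDerivWithin k (G (i+1) f) (Jset (i+1))) (by
        intro i hi
        have := hasJet_of_contDiffOn (hGC f hf (i+1) (by omega) (by omega)) (hJu (i+1) (by omega))
        have hJ := hJset (i+1)
        rw [Nat.add_sub_cancel] at hJ
        rw [← hJ]
        exact this) (by
        intro i hi k hk
        rcases Nat.even_or_odd' i with ⟨q, rfl | rfl⟩
        · exact hjoin f hf k hk (q+1) (by omega) (by omega)
        · have h1 := (hinterp f hf k hk (q+1) (by omega) (by omega)).2
          have h2 := (hinterp f hf k hk (q+2) (by omega) (by omega)).1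
          exact h1.trans h2.symm) (by omega)
    rw [hx0, hxN] at hF
    have hE' : ∀ i, 1 ≤ i → i ≤ N → ∀ k, k ≤ n →
        EqOn (F k) (iteratedDerivWithin k (G i f) (Jset i)) (Jset i) := by
      intro i hi hiN k hk
      obtain ⟨i, rfl⟩ : ∃ i', i = i' + 1 := ⟨i - 1, by omega⟩
      have hJ := hJset (i+1)
      rw [Nat.add_sub_cancel] at hJ
      have := hE i (by omega) k hk
      rw [← hJ] at this
      exact this
    have hcov : ∀ x ∈ Icc (0:ℝ) 1, ∃ i, 1 ≤ i ∧ i ≤ N ∧ x ∈ Jset i := by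
      exact covJ N (by omega) xk hx0 hxN Jset hJset
    have hΦF : EqOn (Φ f) (F 0) (Icc 0 1) := by
      intro x hx
      obtain ⟨i, hi, hiN, hxi⟩ := hcov x hx
      rw [hΦ f hf i hi hiN x hxi, hE' i hi hiN 0 (Nat.zero_le _) hxi, iteratedDerivWithin_zero]
    obtain ⟨h1, h2⟩ := hasJet_congr hF hΦF uI
    refine ⟨h1, fun i hi hiN k hk x hx => ?_⟩
    have hxI : x ∈ Icc (0:ℝ) 1 := by
      rw [hJset] at hx
      rw [← hx0, ← hxN]
      exact Icc_subset_Icc (hxs.monotone (by omega)) (hxs.monotone hiN) hx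
    rw [h2 k hk hxI, hE' i hi hiN k hk hx]
  have hmap : ∀ f, CnI f → CnI (Φ f) := by
    intro f hf
    obtain ⟨h1, h2⟩ := hglue f hf
    rw [hCnI]
    refine ⟨h1, fun j hj k hk => ?_⟩
    rcases Nat.eq_zero_or_pos j with rfl | hj0
    · have h3 := (hinterp f hf k hk 1 le_rfl hM).1
      rw [← h3]
      refine h2 1 le_rfl (by omega) k hk ?_
      rw [hJset]
      exact ⟨le_rfl, hxs.monotone (by omega)⟩
    · have h3 := (hinterp f hf k hk j hj0 hj).2
      rw [← h3]
      refine h2 (2 * j) (by omega) (by omega) k hk ?_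
      rw [hJset]
      exact ⟨hxs.monotone (by omega), le_rfl⟩
  have hend : ∀ f g, CnI f → CnI g → ∀ m, m < n → dK f g m ≤ dK f g (m+1) / 2 := by
    intro f g hf hg m hm
    have hf' := ((hCnI f).1 hf).2
    have hg' := ((hCnI g).1 hg).2
    refine dK_half (hcd f hf) (hcd g hg) hm ?_ ?_
    · have e1 := hf' 0 (Nat.zero_le _) m hm.le
      have e2 := hg' 0 (Nat.zero_le _) m hm.le
      rw [Nat.mul_zero, hx0] at e1 e2
      rw [e1, e2]
    · have e1 := hf' M le_rfl m hm.le
      have e2 := hg' M le_rfl m hm.le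
      rw [← hNM, hxN] at e1 e2
      rw [e1, e2]
  have hcon : ∀ f g, CnI f → CnI g → ∀ k, k ≤ n →
      dK (Φ f) (Φ g) k ≤ 2 ^ n * σ * dK f g k := by
    intro f g hf hg k hk
    refine dK_le _ _ _ _ fun x hx => ?_
    obtain ⟨i, hi, hiN, hxi⟩ := covJ N (by omega) xk hx0 hxN Jset hJset x hx
    rw [(hglue f hf).2 i hi hiN k hk hxi, (hglue g hg).2 i hi hiN k hk hxi]
    have hk' : (k : WithTop ℕ∞) ≤ n := by exact_mod_cast hk
    rw [← iteratedDerivWithin_sub hxi (hJu i hi) ((hGC f hf i hi hiN x hxi).of_le hk')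
      ((hGC g hg i hi hiN x hxi).of_le hk')]
    obtain ⟨a, b, hab, hlt, ha, hb⟩ := hXab i hi hiN
    have hS := hSC i hi hiN
    have hmX := hmapX i hi hiN
    have hσi := hσ i hi hiN
    rw [hab] at hS hmX hσi
    have hprod : ContDiffOn ℝ n (S i * (f - g)) (Icc a b) :=
      hS.mul (((hcd f hf).sub (hcd g hg)).mono (Icc_subset_Icc ha hb))
    have hjet := (hasJet_of_contDiffOn hprod (uniqueDiffOn_Icc hlt)).affine
      (((i / 2 : ℕ) : ℝ) / (N : ℝ)) hmX
    have heq := (hasJet_congr hjet (f := G i f - G i g) (by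
      intro z _
      simp only [Pi.sub_apply, hG, Pi.mul_apply, iteratedDerivWithin_zero, pow_zero]
      ring) (hJu i hi)).2 k hk hxi
    rw [heq]
    have hpb := piece_bound hlt ha hb (hcd f hf) (hcd g hg) hS σ (hend f g hf hg) hσi k hk _ (hmX x hxi)
    rw [abs_mul, abs_of_nonneg (by positivity : (0:ℝ) ≤ 2 ^ k), mul_assoc]
    refine mul_le_mul ?_ hpb (abs_nonneg _) (by positivity)
    exact pow_le_pow_right₀ (by norm_num) hk
  refine ⟨hmap, ?_, ?_⟩
  · intro f g hf hg
    unfold cnDist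
    rw [Finset.mul_sum]
    exact Finset.sum_le_sum fun k hk => hcon f g hf hg k (by simp at hk; omega)
  · intro hlt
    have has : ∀ j, j ≤ M → xk (2 * j) ∈ Icc (0:ℝ) 1 := by
      intro j hj
      rw [← hx0, ← hxN]
      exact ⟨hxs.monotone (by omega), hxs.monotone (by omega)⟩
    obtain ⟨f₀, hf₀⟩ := hermite_ex n M (fun j => xk (2 * j)) (1 / N) (by positivity) (by
      intro p q hpq
      simp only [hxk]
      rw [← sub_div, abs_div, abs_of_pos hNpos]
      gcongr
      have : (1:ℤ) ≤ |((2 * p : ℕ) : ℤ) - ((2 * q : ℕ) : ℤ)| :=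
        Int.one_le_abs (by omega)
      exact_mod_cast this) yv (Icc 0 1) uI has
    exact fix_ex n M (fun j => xk (2 * j)) has yv CnI hCnI Φ hmap (2 ^ n * σ) (by positivity) hlt
      hcon f₀ ((hCnI f₀).2 hf₀)
end

section
/- Let 0 = x_0 < x_1 < ⋯ < x_N = 1 be a partition of [0,1], let X_i = [a_i, b_i] ⊆ [0,1] be closed subintervals of positive length, and let u_i : [a_i, b_i] → [x_{i-1}, x_i] be affine bijections with u_i(a_i) = x_{i-1} and u_i(b_i) = x_i. Let interpolation values y_0,…,y_N ∈ ℝ be given and set C_I := { f ∈ C[0,1] : f(x_j) = y_j for j = 0,…,N }. Suppose λ_i, S_i ∈ C(X_i) have property (S): S_i(a_i) = 0 = S_i(b_i) for all i, λ_1(a_1) = y_0, λ_N(b_N) = y_N, and λ_i(b_i) = y_i = λ_{i+1}(a_{i+1}) for i = 1,…,N−1. Then the operator Φf(x) := λ_i(u_i^{-1}(x)) + S_i(u_i^{-1}(x))·f(u_i^{-1}(x)) for x ∈ u_i(X_i) is well defined and maps C_I into itself; and if max_i ‖S_i‖_{∞,X_i} < 1, then Φ is a contraction on C_I and its unique fixed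 point 𝔣 is a continuous function on [0,1] with 𝔣(x_j) = y_j for all j = 0,…,N. -/
open Set

/-- Continuous local fractal interpolation functions with vanishing endpoint conditions:
for a partition `0 = t₀ < ⋯ < t_N = 1`, closed subintervals `Xᵢ = [aᵢ,bᵢ] ⊆ [0,1]`,
affine bijections `uᵢ : [aᵢ,bᵢ] → [tᵢ₋₁,tᵢ]`, and continuous `λᵢ, Sᵢ` with property (S)
(`Sᵢ(aᵢ) = Sᵢ(bᵢ) = 0` and matching `λᵢ` endpoint values), the Read–Bajraktarević
operator is well defined and maps `C_I` into itself; if `maxᵢ ‖Sᵢ‖_∞ < 1` it is a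
contraction whose unique fixed point is continuous and interpolates the data. -/
theorem stmt17 (N : ℕ) (hN : 0 < N)
    (t : ℕ → ℝ) (ht0 : t 0 = 0) (htN : t N = 1) (htm : ∀ j, j < N → t j < t (j + 1))
    (a b : ℕ → ℝ) (hab : ∀ i, 1 ≤ i → i ≤ N → a i < b i)
    (hsub : ∀ i, 1 ≤ i → i ≤ N → Icc (a i) (b i) ⊆ Icc (0 : ℝ) 1)
    (u : ℕ → ℝ → ℝ)
    (huaff : ∀ i, 1 ≤ i → i ≤ N → ∃ cc dd : ℝ, ∀ x, u i x = cc * x + dd)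
    (hua : ∀ i, 1 ≤ i → i ≤ N → u i (a i) = t (i - 1))
    (hub : ∀ i, 1 ≤ i → i ≤ N → u i (b i) = t i)
    (y : ℕ → ℝ)
    (lam S : ℕ → ℝ → ℝ)
    (hlamc : ∀ i, 1 ≤ i → i ≤ N → ContinuousOn (lam i) (Icc (a i) (b i)))
    (hSc : ∀ i, 1 ≤ i → i ≤ N → ContinuousOn (S i) (Icc (a i) (b i)))
    -- property (S)
    (hS0 : ∀ i, 1 ≤ i → i ≤ N → S i (a i) = 0 ∧ S i (b i) = 0)
    (hlam0 : lam 1 (a 1) = y 0) (hlamN : lam N (b N) = y N)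
    (hlamj : ∀ i, 1 ≤ i → i ≤ N - 1 → lam i (b i) = y i ∧ lam (i + 1) (a (i + 1)) = y i)
    (Φ : (ℝ → ℝ) → (ℝ → ℝ))
    (hΦ : ∀ f : ℝ → ℝ, ∀ i, 1 ≤ i → i ≤ N →
      ∀ x ∈ Icc (a i) (b i), Φ f (u i x) = lam i x + S i x * f x)
    (s : ℝ) (hs0 : 0 ≤ s)
    (hSbd : ∀ i, 1 ≤ i → i ≤ N → ∀ x ∈ Icc (a i) (b i), |S i x| ≤ s) :
    (∀ f : ℝ → ℝ, ContinuousOn f (Icc 0 1) → (∀ j, j ≤ N → f (t j) = y j) →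
      ContinuousOn (Φ f) (Icc 0 1) ∧ ∀ j, j ≤ N → Φ f (t j) = y j) ∧
    (s < 1 →
      (∀ f g : ℝ → ℝ,
        ContinuousOn f (Icc 0 1) → (∀ j, j ≤ N → f (t j) = y j) →
        ContinuousOn g (Icc 0 1) → (∀ j, j ≤ N → g (t j) = y j) →
        ∀ bb : ℝ, (∀ x ∈ Icc (0 : ℝ) 1, |f x - g x| ≤ bb) →
          ∀ x ∈ Icc (0 : ℝ) 1, |Φ f x - Φ g x| ≤ s * bb) ∧
      (∃ 𝔣 : ℝ → ℝ, (ContinuousOn 𝔣 (Icc 0 1) ∧ ∀ j, j ≤ N → 𝔣 (t j) = y j) ∧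
        Set.EqOn (Φ 𝔣) 𝔣 (Icc 0 1) ∧
        ∀ g : ℝ → ℝ, ContinuousOn g (Icc 0 1) → (∀ j, j ≤ N → g (t j) = y j) →
          Set.EqOn (Φ g) g (Icc 0 1) → Set.EqOn g 𝔣 (Icc 0 1))) := by
  have key : ∀ x ∈ Icc (0:ℝ) 1, ∃ i, 1 ≤ i ∧ i ≤ N ∧ x ∈ Icc (t (i-1)) (t i) := by
    have aux : ∀ n, n ≤ N → ∀ x, t 0 ≤ x → x ≤ t n → 0 < n →
        ∃ i, 1 ≤ i ∧ i ≤ N ∧ x ∈ Icc (t (i-1)) (t i) := by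
      intro n
      induction n with
      | zero => intro _ _ _ _ h; omega
      | succ n ih =>
        intro hn x hx0 hx1 _
        by_cases hc : t n ≤ x
        · exact ⟨n+1, by omega, hn, by simpa using hc, hx1⟩
        · rcases Nat.eq_zero_or_pos n with h0 | h0
          · subst h0; exact absurd hx0 hc
          · exact ih (by omega) x hx0 (le_of_not_ge hc) h0
    intro x hx
    exact aux N le_rfl x (by rw [ht0]; exact hx.1) (by rw [htN]; exact hx.2) hN
  have inv : ∀ i, 1 ≤ i → i ≤ N → ∃ v : ℝ → ℝ, Continuous v ∧
      ∀ x ∈ Icc (t (i-1)) (t i), v x ∈ Icc (a i) (b i) ∧ u i (v x) = x := by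
    intro i h1 h2
    have hlt : t (i-1) < t i := by
      have := htm (i-1) (by omega)
      rwa [Nat.sub_add_cancel h1] at this
    have hlt2 := hab i h1 h2
    obtain ⟨cc, dd, hu⟩ := huaff i h1 h2
    have ea := hua i h1 h2
    have eb := hub i h1 h2
    rw [hu] at ea eb
    have hc : 0 < cc := by
      by_contra hcon
      nlinarith
    refine ⟨fun x => (x - dd) / cc, by fun_prop, ?_⟩
    intro x hx
    refine ⟨⟨?_, ?_⟩, ?_⟩
    · rw [le_div_iff₀ hc]; linarith [hx.1]
    · rw [div_le_iff₀ hc]; linarith [hx.2]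
    · rw [hu]; field_simp; ring
  have hpt : ∀ f : ℝ → ℝ, ∀ j, j ≤ N → Φ f (t j) = y j := by
    intro f j hj
    rcases Nat.eq_zero_or_pos j with h0 | h0
    · subst h0
      have h := hΦ f 1 le_rfl hN (a 1) (left_mem_Icc.2 (hab 1 le_rfl hN).le)
      rw [hua 1 le_rfl hN, (hS0 1 le_rfl hN).1, hlam0] at h
      simpa using h
    · have h := hΦ f j h0 hj (b j) (right_mem_Icc.2 (hab j h0 hj).le)
      rw [hub j h0 hj, (hS0 j h0 hj).2] at h
      rw [h, zero_mul, add_zero]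
      rcases Nat.lt_or_ge j N with hl | hl
      · exact (hlamj j h0 (by omega)).1
      · have : j = N := le_antisymm hj hl
        rw [this]; exact hlamN
  have hcont : ∀ f : ℝ → ℝ, ContinuousOn f (Icc 0 1) → ContinuousOn (Φ f) (Icc 0 1) := by
    intro f hf
    have piece : ∀ i, 1 ≤ i → i ≤ N → ContinuousOn (Φ f) (Icc (t (i-1)) (t i)) := by
      intro i h1 h2
      obtain ⟨v, hv, hvm⟩ := inv i h1 h2
      have hm : MapsTo v (Icc (t (i-1)) (t i)) (Icc (a i) (b i)) := fun x hx => (hvm x hx).1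
      have hg : ContinuousOn (fun z => lam i z + S i z * f z) (Icc (a i) (b i)) :=
        (hlamc i h1 h2).add ((hSc i h1 h2).mul (hf.mono (hsub i h1 h2)))
      refine (hg.comp hv.continuousOn hm).congr ?_
      intro x hx
      have h := hΦ f i h1 h2 (v x) (hvm x hx).1
      rw [(hvm x hx).2] at h
      exact h
    have hle : ∀ n, n ≤ N → t 0 ≤ t n := by
      intro n
      induction n with
      | zero => intro _; exact le_rfl
      | succ n ih => intro hn; exact (ih (by omega)).trans (htm n (by omega)).le
    have glue : ∀ n, n ≤ N → ContinuousOn (Φ f) (Icc (t 0) (t n)) := by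
      intro n
      induction n with
      | zero => intro _; rw [Icc_self]; exact continuousOn_singleton _ _
      | succ n ih =>
        intro hn
        rw [← Icc_union_Icc_eq_Icc (hle n (by omega)) (htm n (by omega)).le]
        exact (ih (by omega)).union_of_isClosed (by simpa using piece (n+1) (by omega) hn)
          isClosed_Icc isClosed_Icc
    have := glue N le_rfl
    rwa [ht0, htN] at this
  have hcontr : ∀ f g : ℝ → ℝ, ∀ bb : ℝ, (∀ x ∈ Icc (0 : ℝ) 1, |f x - g x| ≤ bb) →
          ∀ x ∈ Icc (0 : ℝ) 1, |Φ f x - Φ g x| ≤ s * bb := by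
    intro f g bb hb x hx
    obtain ⟨i, h1, h2, hxi⟩ := key x hx
    obtain ⟨v, hv, hvm⟩ := inv i h1 h2
    obtain ⟨hz, hzx⟩ := hvm x hxi
    have ef := hΦ f i h1 h2 _ hz
    have eg := hΦ g i h1 h2 _ hz
    rw [hzx] at ef eg
    rw [ef, eg, show lam i (v x) + S i (v x) * f (v x) - (lam i (v x) + S i (v x) * g (v x))
      = S i (v x) * (f (v x) - g (v x)) by ring, abs_mul]
    exact mul_le_mul (hSbd i h1 h2 _ hz) (hb _ (hsub i h1 h2 hz)) (abs_nonneg _) hs0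
  refine ⟨fun f hf _ => ⟨hcont f hf, hpt f⟩, fun hs1 => ⟨fun f g _ _ _ _ => hcontr f g, ?_⟩⟩
  have h01 : (0:ℝ) ≤ 1 := zero_le_one
  let E : C(Icc (0:ℝ) 1, ℝ) → ℝ → ℝ := fun F => IccExtend h01 F
  have hE : ∀ F, Continuous (E F) := fun F => F.continuous.Icc_extend'
  have hEv : ∀ F, ∀ x : Icc (0:ℝ) 1, E F x = F x := fun F x => IccExtend_val h01 F x
  let T : C(Icc (0:ℝ) 1, ℝ) → C(Icc (0:ℝ) 1, ℝ) := fun F =>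
    ⟨(Icc (0:ℝ) 1).restrict (Φ (E F)), (hcont _ (hE F).continuousOn).restrict⟩
  have hT : ContractingWith ⟨s, hs0⟩ T := by
    refine ⟨by exact_mod_cast hs1, LipschitzWith.of_dist_le_mul ?_⟩
    intro F G
    change dist (T F) (T G) ≤ s * dist F G
    rw [ContinuousMap.dist_le (mul_nonneg hs0 dist_nonneg)]
    intro x
    rw [Real.dist_eq]
    refine hcontr (E F) (E G) (dist F G) ?_ x x.2
    intro z hz
    have := ContinuousMap.dist_apply_le_dist (f := F) (g := G) ⟨z, hz⟩
    rwa [Real.dist_eq, ← hEv, ← hEv] at this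
  have hfix : T (hT.fixedPoint T) = hT.fixedPoint T := hT.fixedPoint_isFixedPt
  set F := hT.fixedPoint T
  have hEq : EqOn (Φ (E F)) (E F) (Icc 0 1) := by
    intro x hx
    have h := congrArg (fun G : C(Icc (0:ℝ) 1, ℝ) => G ⟨x, hx⟩) hfix
    have h2 := hEv F ⟨x, hx⟩
    exact h.trans h2.symm
  have htI : ∀ j, j ≤ N → t j ∈ Icc (0:ℝ) 1 := by
    intro j hj
    have hm : ∀ k m, k + m ≤ N → t k ≤ t (k + m) := by
      intro k m
      induction m with
      | zero => intro _; exact le_rfl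
      | succ m ih => intro hn; exact (ih (by omega)).trans (htm (k+m) (by omega)).le
    have h1 := hm 0 j (by omega)
    have h2 := hm j (N - j) (by omega)
    rw [Nat.add_sub_cancel' hj, htN] at h2
    rw [Nat.zero_add, ht0] at h1
    exact ⟨h1, h2⟩
  refine ⟨E F, ⟨(hE F).continuousOn, fun j hj => ?_⟩, hEq, ?_⟩
  · rw [← hEq (htI j hj)]; exact hpt _ j hj
  · intro g hg _ hgfix
    obtain ⟨x0, hx0, hmax⟩ := isCompact_Icc.exists_isMaxOn (nonempty_Icc.2 h01)
      ((hg.sub (hE F).continuousOn).abs)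
    have hb : ∀ x ∈ Icc (0:ℝ) 1, |g x - E F x| ≤ |g x0 - E F x0| := fun x hx => hmax hx
    have h := hcontr g (E F) _ hb x0 hx0
    rw [hgfix hx0, hEq hx0] at h
    have h0 : |g x0 - E F x0| ≤ 0 := by nlinarith [abs_nonneg (g x0 - E F x0)]
    intro x hx
    have := abs_nonpos_iff.1 ((hb x hx).trans h0)
    linarith
end
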